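/- arXiv:2506.06559 — 2 statements merged into one kernel-verified Lean document; each statement's English description precedes it below -/
import Mathlib

section
/- First-pivotal-bond decomposition (Lemma 2.2). Consider bond percolation on ℤ^d with kernel D at a parameter p ∈ [0,1] such that P_p-almost surely every cluster is finite. Fix M ≥ 1, put W = [−M,M]^d ∩ ℤ^d and let F be a special cylinder event in the window W. Then for all x, x' ∈ ℤ^d with x ≠ x' and x, x' ∉ W: P_p[ F ∩ ({o ↔ x} ∘ {o ↔ x'}) ] = P_p[ F ∩ {W ⇔ x} ∩ ({o ↔ x} ∘ {o ↔ x'}) ] + ∑_{(u₀,v₀)} p D(v₀−u₀) · E_p[ 1_{Ẽ(F;u₀,v₀,x')} · τ_p^{C̃₀}(v₀,x) ], where the sum runs over all ordered pairs (u₀,v₀) of distinct vertices with {u₀,v₀} ∉ E_W. -/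
/-- The vertex set of the hypercubic lattice `ℤ^d`. -/
abbrev Vtx (d : ℕ) := Fin d → ℤ

/-- A bond percolation configuration: each (unordered) pair of vertices is
occupied (`true`) or vacant (`false`). -/
abbrev BondConfig (d : ℕ) := Sym2 (Vtx d) → Bool

/-- The Euclidean norm of a point of `ℤ^d`. -/
noncomputable def znorm {d : ℕ} (x : Vtx d) : ℝ :=
  Real.sqrt (∑ i, ((x i : ℝ)) ^ 2)

/-- The edge between `a` and `b` is occupied (an edge requires `a ≠ b`). -/
def occEdge {d : ℕ} (ω : BondConfig d) (a b : Vtx d) : Prop :=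
  a ≠ b ∧ ω s(a, b) = true

/-- `a` and `b` are joined by a path of occupied edges (`a ↔ b`);
`a ↔ a` always holds. -/
def Conn {d : ℕ} (ω : BondConfig d) (a b : Vtx d) : Prop :=
  Relation.ReflTransGen (occEdge ω) a b

/-- The connection event `{a ↔ b}`. -/
def ConnEvent {d : ℕ} (a b : Vtx d) : Set (BondConfig d) :=
  {ω | Conn ω a b}

/-- The event `{A ↔ b}` that some vertex of `A` is connected to `b`. -/
def ConnToSet {d : ℕ} (A : Set (Vtx d)) (b : Vtx d) : Set (BondConfig d) :=
  {ω | ∃ a ∈ A, Conn ω a b}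

/-- Disjoint occurrence `A ∘ B` of two events. -/
def DisjOcc {d : ℕ} (A B : Set (BondConfig d)) : Set (BondConfig d) :=
  {ω | ∃ B₁ B₂ : Set (Sym2 (Vtx d)), Disjoint B₁ B₂ ∧
    (∀ ω' : BondConfig d, (∀ e ∈ B₁, ω' e = ω e) → ω' ∈ A) ∧
    (∀ ω' : BondConfig d, (∀ e ∈ B₂, ω' e = ω e) → ω' ∈ B)}

/-- The event `{W ⇔ u} = ⋃_{w, w' ∈ W} {w ↔ u} ∘ {w' ↔ u}`. -/
def WDouble {d : ℕ} (W : Set (Vtx d)) (u : Vtx d) : Set (BondConfig d) :=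
  ⋃ (w ∈ W) (w' ∈ W), DisjOcc (ConnEvent w u) (ConnEvent w' u)

/-- The event that every edge of the finite edge set `E` is occupied. -/
def occupiedEvent {d : ℕ} (E : Finset (Sym2 (Vtx d))) : Set (BondConfig d) :=
  {ω | ∀ e ∈ E, ω e = true}

/-- `V(E)`: the set of endpoints of the edges of `E`. -/
def edgeVerts {d : ℕ} (E : Finset (Sym2 (Vtx d))) : Set (Vtx d) :=
  {v | ∃ e ∈ E, v ∈ e}

open MeasureTheory
open scoped ENNReal Classical

/-- The probability that the edge `e` is occupied, for the percolation model with
parameter `p` and (symmetric) kernel `D`; for a symmetric `D` this is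
`p · D(y − x)` on the edge `{x, y}`. -/
noncomputable def edgeProb {d : ℕ} (p : ℝ) (D : Vtx d → ℝ) : Sym2 (Vtx d) → ℝ :=
  Sym2.lift ⟨fun a b => p * ((D (b - a) + D (a - b)) / 2), fun a b => by ring⟩

/-- `P` is the Bernoulli bond percolation measure with parameter `p` and kernel `D`:
a probability measure under which the edge occupation variables are independent,
edge `e` being occupied with probability `p · D(e)`. -/
def IsBernoulli {d : ℕ} (P : Measure (BondConfig d)) (p : ℝ) (D : Vtx d → ℝ) : Prop :=
  IsProbabilityMeasure P ∧
    ∀ (s : Finset (Sym2 (Vtx d))) (σ : Sym2 (Vtx d) → Bool),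
      P {ω | ∀ e ∈ s, ω e = σ e} =
        ∏ e ∈ s,
          ENNReal.ofReal (if σ e then edgeProb p D e else 1 - edgeProb p D e)

/-- The two-point function `τ(a, b)` of the measure `P`, as an extended real. -/
noncomputable def twoPoint {d : ℕ} (P : Measure (BondConfig d)) (a b : Vtx d) : ℝ≥0∞ :=
  P (ConnEvent a b)

/-- The critical point: the supremum of the parameters `p ∈ [0,1]` for which the
two-point function is summable. -/
noncomputable def pcOf {d : ℕ} (P : ℝ → Measure (BondConfig d)) : ℝ :=
  sSup {p : ℝ | p ∈ Set.Icc (0 : ℝ) 1 ∧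
    Summable fun x : Vtx d => (twoPoint (P p) 0 x).toReal}

/-- The two-arm event `{o ↔ x} ∘ {o ↔ x'}`. -/
def TwoArm {d : ℕ} (x x' : Vtx d) : Set (BondConfig d) :=
  DisjOcc (ConnEvent 0 x) (ConnEvent 0 x')

/-- A cylinder event: an event depending on the occupation status of only
finitely many edges. -/
def IsCylinderEvent {d : ℕ} (F : Set (BondConfig d)) : Prop :=
  ∃ s : Finset (Sym2 (Vtx d)), ∀ ω ω' : BondConfig d,
    (∀ e ∈ s, ω e = ω' e) → (ω ∈ F ↔ ω' ∈ F)

/-- The box `W = [−M, M]^d ∩ ℤ^d`. -/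
def boxSet (d : ℕ) (M : ℕ) : Set (Vtx d) :=
  {v | ∀ i, |v i| ≤ (M : ℤ)}

/-- `E_W`: the set of bonds with both endpoints in the box `W = [−M, M]^d`. -/
def boxEdges (d : ℕ) (M : ℕ) : Set (Sym2 (Vtx d)) :=
  {e | ¬ e.IsDiag ∧ ∀ v ∈ e, v ∈ boxSet d M}

/-- The special cylinder event determined by the partition `(B₁, B₂)` of `E_W`:
all bonds of `B₁` are occupied and all bonds of `B₂` are vacant. -/
def specialEvent {d : ℕ} (B₁ B₂ : Set (Sym2 (Vtx d))) : Set (BondConfig d) :=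
  {ω | (∀ e ∈ B₁, ω e = true) ∧ ∀ e ∈ B₂, ω e = false}
/-- The configuration `ω` with the edge `e₀` made vacant. -/
def offEdge {d : ℕ} (ω : BondConfig d) (e₀ : Sym2 (Vtx d)) : BondConfig d :=
  fun e => if e = e₀ then false else ω e

/-- `a` and `b` are connected by an occupied path all of whose vertices lie in `S`
(or `a = b ∈ S`). -/
def ConnIn {d : ℕ} (ω : BondConfig d) (S : Set (Vtx d)) (a b : Vtx d) : Prop :=
  a ∈ S ∧ Relation.ReflTransGen (fun u v => v ∈ S ∧ occEdge ω u v) a b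

/-- The restricted cluster `C̃₀ = C̃₀(W; u₀, v₀; ω)` of the box `W = [−M,M]^d`:
all vertices connected to `W` after the bond `{u₀, v₀}` is made vacant. -/
def Ctilde {d : ℕ} (M : ℕ) (u₀ v₀ : Vtx d) (ω : BondConfig d) : Set (Vtx d) :=
  {y | ∃ w ∈ boxSet d M, Conn (offEdge ω s(u₀, v₀)) w y}

/-- The event `Ẽ(F; u₀, v₀, x')`: the special cylinder event `F = F(B₁, B₂)` occurs,
and on the configuration with `{u₀, v₀}` made vacant, `W ⇔ u₀` and
`{o ↔ u₀} ∘ {o ↔ x'}` occur. -/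
def tildeE {d : ℕ} (M : ℕ) (B₁ B₂ : Set (Sym2 (Vtx d))) (u₀ v₀ x' : Vtx d) :
    Set (BondConfig d) :=
  specialEvent B₁ B₂ ∩
    {ω | offEdge ω s(u₀, v₀) ∈
      WDouble (boxSet d M) u₀ ∩ DisjOcc (ConnEvent 0 u₀) (ConnEvent 0 x')}

/-! ### Connections inside a set of edges -/

section EdgeSets

variable {V : Type*}

/-- `a` and `b` are joined by a path all of whose edges lie in `S`. -/
def EdgeConn (S : Set (Sym2 V)) (a b : V) : Prop :=
  Relation.ReflTransGen (fun u v => u ≠ v ∧ s(u, v) ∈ S) a b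

/-- Some vertex of `W` is joined to `y` by a path in `S`. -/
def Reaches (S : Set (Sym2 V)) (W : Set V) (y : V) : Prop :=
  ∃ w ∈ W, EdgeConn S w y

/-- There are two edge-disjoint paths in `G` from `W` to `y`. -/
def DoublyReaches (G : Set (Sym2 V)) (W : Set V) (y : V) : Prop :=
  ∃ S ⊆ G, ∃ T ⊆ G, Disjoint S T ∧ Reaches S W y ∧ Reaches T W y

/-- The edges with an endpoint in `C`. -/
def touching (C : Set V) : Set (Sym2 V) := {e | ∃ v ∈ e, v ∈ C}

/-- The edges with both endpoints outside `C`. -/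
def avoiding (C : Set V) : Set (Sym2 V) := {e | ∀ v ∈ e, v ∉ C}

/-- The vertices that are joined to `W` without using the edge `{u, v}`. -/
def clusterWithout (G : Set (Sym2 V)) (W : Set V) (u v : V) : Set V :=
  {y | Reaches (G \ {s(u, v)}) W y}

/-- The edge `{u, v}` is the first pivotal edge for the connection in `G` from `W` to `x`,
and it is crossed from `u` to `v`. -/
def FirstPivotal (G : Set (Sym2 V)) (W : Set V) (u v x : V) : Prop :=
  u ≠ v ∧ s(u, v) ∈ G ∧ DoublyReaches (G \ {s(u, v)}) W u ∧
    v ∉ clusterWithout G W u v ∧ EdgeConn (G ∩ avoiding (clusterWithout G W u v)) v x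

lemma EdgeConn.mono {S T : Set (Sym2 V)} (h : S ⊆ T) {a b : V} (hab : EdgeConn S a b) :
    EdgeConn T a b :=
  Relation.ReflTransGen.mono (fun _ _ hxy => ⟨hxy.1, h hxy.2⟩) a b hab

lemma EdgeConn.snoc {S : Set (Sym2 V)} {a b c : V} (hab : EdgeConn S a b) (hne : b ≠ c)
    (h : s(b, c) ∈ S) : EdgeConn S a c :=
  Relation.ReflTransGen.tail hab ⟨hne, h⟩

lemma EdgeConn.trans {S : Set (Sym2 V)} {a b c : V} (hab : EdgeConn S a b)
    (hbc : EdgeConn S b c) : EdgeConn S a c :=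
  Relation.ReflTransGen.trans hab hbc

lemma Reaches.mono {S T : Set (Sym2 V)} (h : S ⊆ T) {W : Set V} {y : V} (hy : Reaches S W y) :
    Reaches T W y :=
  let ⟨w, hw, hwy⟩ := hy
  ⟨w, hw, hwy.mono h⟩

lemma Reaches.snoc {S : Set (Sym2 V)} {W : Set V} {b c : V} (hb : Reaches S W b) (hne : b ≠ c)
    (h : s(b, c) ∈ S) : Reaches S W c :=
  let ⟨w, hw, hwb⟩ := hb
  ⟨w, hw, hwb.snoc hne h⟩

lemma Reaches.trans {S : Set (Sym2 V)} {W : Set V} {b c : V} (hb : Reaches S W b)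
    (h : EdgeConn S b c) : Reaches S W c :=
  let ⟨w, hw, hwb⟩ := hb
  ⟨w, hw, hwb.trans h⟩

lemma reaches_of_mem (S : Set (Sym2 V)) {W : Set V} {w : V} (hw : w ∈ W) : Reaches S W w :=
  ⟨w, hw, Relation.ReflTransGen.refl⟩

/-- A path can be cut at its first visit of an endpoint of a given edge. -/
lemma EdgeConn.diff_edge {S : Set (Sym2 V)} (u v : V) {a b : V} (h : EdgeConn S a b) :
    EdgeConn (S \ {s(u, v)}) a b ∨ EdgeConn (S \ {s(u, v)}) a u ∨
      EdgeConn (S \ {s(u, v)}) a v := by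
  induction h with
  | refl => exact Or.inl Relation.ReflTransGen.refl
  | @tail b c _ hbc ih =>
    rcases ih with h | h
    · by_cases he : s(b, c) = s(u, v)
      · rcases Sym2.eq_iff.1 he with ⟨rfl, rfl⟩ | ⟨rfl, rfl⟩
        · exact Or.inr (Or.inl h)
        · exact Or.inr (Or.inr h)
      · exact Or.inl (h.snoc hbc.1 ⟨hbc.2, he⟩)
    · exact Or.inr h

lemma EdgeConn.of_closed {S : Set (Sym2 V)} {C : Set V} {a b : V} (h : EdgeConn S a b)
    (ha : a ∈ C) (hC : ∀ y ∈ C, ∀ z, y ≠ z → s(y, z) ∈ S → z ∈ C) :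
    b ∈ C ∧ EdgeConn (S ∩ {e | ∀ v ∈ e, v ∈ C}) a b := by
  induction h with
  | refl => exact ⟨ha, Relation.ReflTransGen.refl⟩
  | @tail b c _ hbc ih =>
    have hc := hC b ih.1 c hbc.1 hbc.2
    refine ⟨hc, ih.2.snoc hbc.1 ⟨hbc.2, ?_⟩⟩
    intro v hv
    rcases Sym2.mem_iff.1 hv with rfl | rfl
    exacts [ih.1, hc]

lemma Reaches.inside {S : Set (Sym2 V)} {W : Set V} {y : V} (h : Reaches S W y) :
    Reaches (S ∩ {e | ∀ v ∈ e, Reaches S W v}) W y :=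
  let ⟨w, hw, hwy⟩ := h
  ⟨w, hw, (hwy.of_closed (C := {v | Reaches S W v}) (reaches_of_mem S hw)
    fun _ hy _ hne he => Reaches.snoc hy hne he).2⟩

lemma EdgeConn.exists_finset {S : Set (Sym2 V)} {a b : V} (h : EdgeConn S a b) :
    ∃ s : Finset (Sym2 V), (s : Set (Sym2 V)) ⊆ S ∧ EdgeConn (s : Set (Sym2 V)) a b := by
  induction h with
  | refl => exact ⟨∅, by simp, Relation.ReflTransGen.refl⟩
  | @tail b c _ hbc ih =>
    obtain ⟨s, hs, hab⟩ := ih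
    refine ⟨insert s(b, c) s, ?_, (hab.mono ?_).snoc hbc.1 ?_⟩
    · rw [Finset.coe_insert]
      exact Set.insert_subset hbc.2 hs
    · simp
    · simp

/-- Augmentation: given two edge-disjoint paths from `W` to `y` and a further path from `W`
to `z`, none of which uses `{y, z}`, there are two edge-disjoint paths from `W` to `z`. -/
lemma DoublyReaches.augment {G : Set (Sym2 V)} {W : Set V} {y z : V} (hne : y ≠ z)
    (he : s(y, z) ∈ G) (hz : Reaches (G \ {s(y, z)}) W z)
    (h : DoublyReaches (G \ {s(y, z)}) W y) : DoublyReaches G W z := by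
  obtain ⟨S, hS, T, hT, hST, hSy, hTy⟩ := h
  set R : Set (Sym2 V) :=
    {f | f ∈ G \ {s(y, z)} ∧ ∃ v ∈ f, ¬ Reaches S W v ∧ ¬ Reaches T W v} with hR
  have key : ∃ q, (Reaches S W q ∨ Reaches T W q) ∧ EdgeConn R q z := by
    obtain ⟨w, hw, hwz⟩ := hz
    have : (∃ q, (Reaches S W q ∨ Reaches T W q) ∧ EdgeConn R q z) ∨ EdgeConn R w z := by
      clear hw
      induction hwz using Relation.ReflTransGen.head_induction_on with
      | refl => exact Or.inr Relation.ReflTransGen.refl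
      | @head a c hac _ ih =>
        rcases ih with ih | ih
        · exact Or.inl ih
        · by_cases hc : Reaches S W c ∨ Reaches T W c
          · exact Or.inl ⟨c, hc, ih⟩
          · exact Or.inr (Relation.ReflTransGen.head
              ⟨hac.1, hac.2, c, Sym2.mem_mk_right a c, not_or.1 hc⟩ ih)
    rcases this with h | h
    exacts [h, ⟨w, Or.inl (reaches_of_mem S hw), h⟩]
  have combine : ∀ S T : Set (Sym2 V), S ⊆ G \ {s(y, z)} → T ⊆ G \ {s(y, z)} → Disjoint S T →
      Reaches T W y → (∀ f ∈ R, ∃ v ∈ f, ¬ Reaches S W v ∧ ¬ Reaches T W v) →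
      (∃ q, Reaches S W q ∧ EdgeConn R q z) → DoublyReaches G W z := by
    rintro S T hS hT hST hTy hRv ⟨q, hq, hqz⟩
    refine ⟨S ∪ R, ?_, (T ∩ {f | ∀ v ∈ f, Reaches T W v}) ∪ {s(y, z)}, ?_, ?_, ?_, ?_⟩
    · exact Set.union_subset (fun f hf => (hS hf).1) fun f hf => hf.1.1
    · exact Set.union_subset (fun f hf => (hT hf.1).1) (Set.singleton_subset_iff.2 he)
    · rw [Set.disjoint_left]
      rintro f (hf | hf) (hf' | hf')
      · exact Set.disjoint_left.1 hST hf hf'.1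
      · exact (hS hf).2 hf'
      · obtain ⟨v, hv, -, hv'⟩ := hRv f hf
        exact hv' (hf'.2 v hv)
      · exact hf.1.2 hf'
    · exact (hq.mono Set.subset_union_left).trans (hqz.mono Set.subset_union_right)
    · exact (hTy.inside.mono Set.subset_union_left).snoc hne (Or.inr rfl)
  obtain ⟨q, hq | hq, hqz⟩ := key
  · exact combine S T hS hT hST hTy (fun f hf => hf.2) ⟨q, hq, hqz⟩
  · exact combine T S hT hS hST.symm hSy
      (fun f hf => let ⟨v, hv, h⟩ := hf.2; ⟨v, hv, h.symm⟩) ⟨q, hq, hqz⟩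

lemma Reaches.diff_edge {S : Set (Sym2 V)} {W : Set V} {y : V} (z : V) (h : Reaches S W y) :
    Reaches (S \ {s(y, z)}) W y ∨ Reaches (S \ {s(y, z)}) W z := by
  obtain ⟨w, hw, hwy⟩ := h
  rcases hwy.diff_edge y z with h | h | h
  exacts [Or.inl ⟨w, hw, h⟩, Or.inl ⟨w, hw, h⟩, Or.inr ⟨w, hw, h⟩]

lemma doublyReaches_of_reaches_diff {G S T : Set (Sym2 V)} {W : Set V} {y z : V} (hne : y ≠ z)
    (he : s(y, z) ∈ G) (hS : S ⊆ G) (hT : T ⊆ G) (hST : Disjoint S T)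
    (hSz : Reaches (S \ {s(y, z)}) W z) (hTy : Reaches (T \ {s(y, z)}) W y) :
    DoublyReaches G W z := by
  refine ⟨S \ {s(y, z)}, fun f hf => hS hf.1, T ∪ {s(y, z)},
    Set.union_subset hT (Set.singleton_subset_iff.2 he), ?_, hSz, ?_⟩
  · rw [Set.disjoint_left]
    rintro f hf (hf' | hf')
    exacts [Set.disjoint_left.1 hST hf.1 hf', hf.2 hf']
  · exact (hTy.mono fun f hf => Or.inl hf.1).snoc hne (Or.inr rfl)

/-- One more edge after a double connection: the connection stays double, or the new edge is
the first pivotal edge. -/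
lemma DoublyReaches.step {G : Set (Sym2 V)} {W : Set V} {y z : V} (hne : y ≠ z)
    (he : s(y, z) ∈ G) (h : DoublyReaches G W y) :
    DoublyReaches G W z ∨ FirstPivotal G W y z z := by
  obtain ⟨S, hS, T, hT, hST, hSy, hTy⟩ := h
  have hd : ∀ {S' : Set (Sym2 V)}, S' ⊆ G → S' \ {s(y, z)} ⊆ G \ {s(y, z)} :=
    fun h => Set.sdiff_subset_sdiff_left h
  by_cases hSy' : Reaches (S \ {s(y, z)}) W y
  · by_cases hTy' : Reaches (T \ {s(y, z)}) W y
    · have hdbl : DoublyReaches (G \ {s(y, z)}) W y :=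
        ⟨_, hd hS, _, hd hT, hST.mono Set.sdiff_subset Set.sdiff_subset, hSy', hTy'⟩
      by_cases hz : Reaches (G \ {s(y, z)}) W z
      · exact Or.inl (hdbl.augment hne he hz)
      · exact Or.inr ⟨hne, he, hdbl, hz, Relation.ReflTransGen.refl⟩
    · have hTz := (hTy.diff_edge z).resolve_left hTy'
      exact Or.inl (doublyReaches_of_reaches_diff hne he hT hS hST.symm hTz hSy')
  · have hSz := (hSy.diff_edge z).resolve_left hSy'
    by_cases hTy' : Reaches (T \ {s(y, z)}) W y
    · exact Or.inl (doublyReaches_of_reaches_diff hne he hS hT hST hSz hTy')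
    · have hTz := (hTy.diff_edge z).resolve_left hTy'
      exact Or.inl ⟨_, fun f hf => hS hf.1, _, fun f hf => hT hf.1,
        hST.mono Set.sdiff_subset Set.sdiff_subset, hSz, hTz⟩

/-- The two-path case of Menger's theorem: a connection that is not double has a first pivotal
edge. -/
lemma doublyReaches_or_firstPivotal {G : Set (Sym2 V)} {W : Set V} {x : V}
    (h : Reaches G W x) : DoublyReaches G W x ∨ ∃ u v, FirstPivotal G W u v x := by
  obtain ⟨w, hw, hwx⟩ := h
  induction hwx with
  | refl =>
    exact Or.inl ⟨∅, Set.empty_subset _, ∅, Set.empty_subset _, disjoint_bot_left,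
      reaches_of_mem _ hw, reaches_of_mem _ hw⟩
  | @tail y z _ hyz ih =>
    rcases ih with ih | ⟨u, v, huv, he, hu, hv, hvy⟩
    · exact (ih.step hyz.1 hyz.2).imp_right fun h => ⟨y, z, h⟩
    · have hy : y ∉ clusterWithout G W u v :=
        (hvy.of_closed (C := (clusterWithout G W u v)ᶜ) hv
          fun _ _ z _ hz => hz.2 z (Sym2.mem_mk_right _ _)).1
      by_cases hz : z ∈ clusterWithout G W u v
      · have heq : s(y, z) = s(u, v) := by
          by_contra hcon
          refine hy (Reaches.snoc hz hyz.1.symm ⟨?_, ?_⟩)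
          · rw [Sym2.eq_swap]; exact hyz.2
          · exact fun h => hcon (Sym2.eq_swap.trans h)
        rcases Sym2.eq_iff.1 heq with ⟨-, rfl⟩ | ⟨-, rfl⟩
        · exact absurd hz hv
        · obtain ⟨S, hS, T, hT, hST, h⟩ := hu
          exact Or.inl ⟨S, hS.trans Set.sdiff_subset, T, hT.trans Set.sdiff_subset, hST, h⟩
      · refine Or.inr ⟨u, v, huv, he, hu, hv, hvy.snoc hyz.1 ⟨hyz.2, ?_⟩⟩
        intro t ht
        rcases Sym2.mem_iff.1 ht with rfl | rfl
        exacts [hy, hz]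

lemma FirstPivotal.not_mem {G : Set (Sym2 V)} {W : Set V} {u v x : V}
    (h : FirstPivotal G W u v x) : x ∉ clusterWithout G W u v :=
  (h.2.2.2.2.of_closed (C := (clusterWithout G W u v)ᶜ) h.2.2.2.1
    fun _ _ z _ hz => hz.2 z (Sym2.mem_mk_right _ _)).1

/-- Every set of edges that connects `W` to `x` contains each pivotal edge. -/
lemma FirstPivotal.mem_of_reaches {G S : Set (Sym2 V)} {W : Set V} {u v x : V}
    (h : FirstPivotal G W u v x) (hS : S ⊆ G) (hx : Reaches S W x) : s(u, v) ∈ S := by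
  by_contra hcon
  exact h.not_mem (hx.mono (Set.subset_sdiff_singleton hS hcon))

lemma FirstPivotal.not_doublyReaches {G : Set (Sym2 V)} {W : Set V} {u v x : V}
    (h : FirstPivotal G W u v x) : ¬ DoublyReaches G W x := by
  rintro ⟨S, hS, T, hT, hST, hSx, hTx⟩
  exact Set.disjoint_left.1 hST (h.mem_of_reaches hS hSx) (h.mem_of_reaches hT hTx)

lemma DoublyReaches.reaches_diff {G : Set (Sym2 V)} {W : Set V} {u : V}
    (h : DoublyReaches G W u) (e : Sym2 V) : Reaches (G \ {e}) W u := by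
  obtain ⟨S, hS, T, hT, hST, hSu, hTu⟩ := h
  by_cases he : e ∈ S
  · exact hTu.mono (Set.subset_sdiff_singleton hT (Set.disjoint_left.1 hST he))
  · exact hSu.mono (Set.subset_sdiff_singleton hS he)

lemma DoublyReaches.reaches {G : Set (Sym2 V)} {W : Set V} {u : V}
    (h : DoublyReaches G W u) : Reaches G W u :=
  let ⟨_, hS, _, _, _, hSu, _⟩ := h
  hSu.mono hS

lemma FirstPivotal.unique {G : Set (Sym2 V)} {W : Set V} {u v u' v' x : V}
    (h : FirstPivotal G W u v x) (h' : FirstPivotal G W u' v' x) : u = u' ∧ v = v' := by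
  by_cases heq : s(u, v) = s(u', v')
  · rcases Sym2.eq_iff.1 heq with h1 | ⟨rfl, rfl⟩
    · exact h1
    · refine absurd ?_ h.2.2.2.1
      have := h'.2.2.1.reaches
      rwa [Sym2.eq_swap] at this
  · exfalso
    have hmem : u' ∈ clusterWithout G W u v :=
      (h'.2.2.1.reaches_diff s(u, v)).mono
        (Set.sdiff_subset_sdiff_left Set.sdiff_subset)
    refine h'.not_mem (Reaches.trans (b := v) (Reaches.snoc (b := u) ?_ h.1 ⟨h.2.1, heq⟩)
      (h.2.2.2.2.mono ?_))
    · exact (h.2.2.1.reaches_diff s(u', v')).mono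
        (Set.sdiff_subset_sdiff_left Set.sdiff_subset)
    · rintro f ⟨hf, hav⟩
      refine ⟨hf, ?_⟩
      rintro rfl
      exact hav u' (Sym2.mem_mk_left _ _) hmem

/-- Two edge-disjoint arms from `a ∈ W` to `x` and `x'` correspond to two edge-disjoint arms
from `a` to `u` and `x'` that avoid the first pivotal edge `{u, v}` for `x`. -/
lemma FirstPivotal.twoArm_iff {G : Set (Sym2 V)} {W : Set V} {u v x : V}
    (h : FirstPivotal G W u v x) {a : V} (ha : a ∈ W) (x' : V) :
    (∃ S ⊆ G, ∃ T ⊆ G, Disjoint S T ∧ EdgeConn S a x ∧ EdgeConn T a x') ↔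
      ∃ S ⊆ G \ {s(u, v)}, ∃ T ⊆ G \ {s(u, v)},
        Disjoint S T ∧ EdgeConn S a u ∧ EdgeConn T a x' := by
  constructor
  · rintro ⟨S, hS, T, hT, hST, hSx, hTx⟩
    have he := h.mem_of_reaches hS ⟨a, ha, hSx⟩
    have hSd : S \ {s(u, v)} ⊆ G \ {s(u, v)} := Set.sdiff_subset_sdiff_left hS
    refine ⟨S \ {s(u, v)}, hSd, T,
      Set.subset_sdiff_singleton hT (Set.disjoint_left.1 hST he),
      hST.mono_left Set.sdiff_subset, ?_, hTx⟩
    rcases hSx.diff_edge u v with h1 | h1 | h1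
    · exact absurd ⟨a, ha, h1.mono hSd⟩ h.not_mem
    · exact h1
    · exact absurd ⟨a, ha, h1.mono hSd⟩ h.2.2.2.1
  · rintro ⟨S, hS, T, hT, hST, hSu, hTx⟩
    set C := clusterWithout G W u v with hC
    have haC : a ∈ C := reaches_of_mem _ ha
    have hTx' := (hTx.of_closed (C := C) haC
      fun _ hy _ hne he => Reaches.snoc hy hne (hT he)).2
    refine ⟨S \ T ∪ {s(u, v)} ∪ (G ∩ avoiding C), ?_, T ∩ {e | ∀ v ∈ e, v ∈ C},
      fun f hf => (hT hf.1).1, ?_, ?_, hTx'⟩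
    · rintro f ((hf | rfl) | hf)
      exacts [(hS hf.1).1, h.2.1, hf.1]
    · rw [Set.disjoint_left]
      rintro f ((hf | rfl) | hf) hf'
      · exact hf.2 hf'.1
      · exact (hT hf'.1).2 rfl
      · induction f using Sym2.ind with
        | _ b c => exact hf.2 b (Sym2.mem_mk_left _ _) (hf'.2 b (Sym2.mem_mk_left _ _))
    · refine ((hSu.mono ?_).snoc h.1 (Or.inl (Or.inr rfl))).trans
        (h.2.2.2.2.mono Set.subset_union_right)
      rw [hST.sdiff_eq_left]
      exact fun f hf => Or.inl (Or.inl hf)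

end EdgeSets

/-! ### Percolation events in terms of edge sets -/

section Events

variable {d : ℕ}

/-- The set of occupied edges. -/
def occSet (ω : BondConfig d) : Set (Sym2 (Vtx d)) := {e | ω e = true}

/-- The configuration in which only the occupied edges of `T` are kept. -/
noncomputable def restrictTo (T : Set (Sym2 (Vtx d))) (ω : BondConfig d) : BondConfig d :=
  fun e => if e ∈ T then ω e else false

lemma occSet_restrictTo (T : Set (Sym2 (Vtx d))) (ω : BondConfig d) :
    occSet (restrictTo T ω) = occSet ω ∩ T := by
  ext e
  by_cases h : e ∈ T <;> simp [occSet, restrictTo, h]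

lemma offEdge_eq_restrictTo (e : Sym2 (Vtx d)) (ω : BondConfig d) :
    offEdge ω e = restrictTo {e}ᶜ ω := by
  ext f
  by_cases h : f = e <;> simp [offEdge, restrictTo, h]

lemma occSet_offEdge (e : Sym2 (Vtx d)) (ω : BondConfig d) :
    occSet (offEdge ω e) = occSet ω \ {e} := by
  rw [offEdge_eq_restrictTo, occSet_restrictTo, Set.sdiff_eq]

lemma mem_connEvent {a b : Vtx d} {ω : BondConfig d} :
    ω ∈ ConnEvent a b ↔ EdgeConn (occSet ω) a b :=
  Iff.rfl

lemma mem_disjOcc_connEvent {a b a' b' : Vtx d} {ω : BondConfig d} :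
    ω ∈ DisjOcc (ConnEvent a b) (ConnEvent a' b') ↔
      ∃ S ⊆ occSet ω, ∃ T ⊆ occSet ω, Disjoint S T ∧ EdgeConn S a b ∧ EdgeConn T a' b' := by
  constructor
  · rintro ⟨S, T, hST, hS, hT⟩
    have key : ∀ (U : Set (Sym2 (Vtx d))) {c c' : Vtx d},
        (∀ ω' : BondConfig d, (∀ e ∈ U, ω' e = ω e) → ω' ∈ ConnEvent c c') →
        EdgeConn (occSet ω ∩ U) c c' := by
      intro U c c' h
      have := h (restrictTo U ω) fun e he => if_pos he
      rwa [mem_connEvent, occSet_restrictTo] at this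
    exact ⟨_, Set.inter_subset_left, _, Set.inter_subset_left,
      hST.mono Set.inter_subset_right Set.inter_subset_right, key S hS, key T hT⟩
  · rintro ⟨S, hS, T, hT, hST, hab, hab'⟩
    exact ⟨S, T, hST, fun ω' h => hab.mono fun e he => (h e he).trans (hS he),
      fun ω' h => hab'.mono fun e he => (h e he).trans (hT he)⟩

lemma mem_wDouble {W : Set (Vtx d)} {u : Vtx d} {ω : BondConfig d} :
    ω ∈ WDouble W u ↔ DoublyReaches (occSet ω) W u := by
  simp only [WDouble, Set.mem_iUnion, mem_disjOcc_connEvent]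
  constructor
  · rintro ⟨w, hw, w', hw', S, hS, T, hT, hST, h, h'⟩
    exact ⟨S, hS, T, hT, hST, ⟨w, hw, h⟩, ⟨w', hw', h'⟩⟩
  · rintro ⟨S, hS, T, hT, hST, ⟨w, hw, h⟩, ⟨w', hw', h'⟩⟩
    exact ⟨w, hw, w', hw', S, hS, T, hT, hST, h, h'⟩

lemma cTilde_eq (M : ℕ) (u v : Vtx d) (ω : BondConfig d) :
    Ctilde M u v ω = clusterWithout (occSet ω) (boxSet d M) u v := by
  rw [clusterWithout, ← occSet_offEdge]
  rfl

lemma connIn_compl_iff {C : Set (Vtx d)} {v x : Vtx d} {ω : BondConfig d} :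
    ConnIn ω Cᶜ v x ↔ v ∉ C ∧ EdgeConn (occSet ω ∩ avoiding C) v x := by
  constructor
  · rintro ⟨hv, h⟩
    suffices x ∉ C ∧ EdgeConn (occSet ω ∩ avoiding C) v x from ⟨hv, this.2⟩
    induction h with
    | refl => exact ⟨hv, Relation.ReflTransGen.refl⟩
    | @tail b c _ hbc ih =>
      refine ⟨hbc.1, ih.2.snoc hbc.2.1 ⟨hbc.2.2, ?_⟩⟩
      intro t ht
      rcases Sym2.mem_iff.1 ht with rfl | rfl
      exacts [ih.1, hbc.1]
  · rintro ⟨hv, h⟩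
    exact ⟨hv, Relation.ReflTransGen.mono
      (fun _ c hbc => ⟨hbc.2.2 c (Sym2.mem_mk_right _ _), hbc.1, hbc.2.1⟩) v x h⟩

lemma zero_mem_boxSet (M : ℕ) : (0 : Vtx d) ∈ boxSet d M := fun i => by simp

lemma boxSet_finite (M : ℕ) : (boxSet d M).Finite :=
  (Set.finite_Icc (fun _ => -(M : ℤ)) fun _ => (M : ℤ)).subset fun _ hv =>
    ⟨fun i => (abs_le.1 (hv i)).1, fun i => (abs_le.1 (hv i)).2⟩

lemma mem_tildeE {M : ℕ} {B₁ B₂ : Set (Sym2 (Vtx d))} {u v x' : Vtx d} {ω : BondConfig d} :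
    ω ∈ tildeE M B₁ B₂ u v x' ↔ ω ∈ specialEvent B₁ B₂ ∧
      DoublyReaches (occSet ω \ {s(u, v)}) (boxSet d M) u ∧
      ∃ S ⊆ occSet ω \ {s(u, v)}, ∃ T ⊆ occSet ω \ {s(u, v)},
        Disjoint S T ∧ EdgeConn S 0 u ∧ EdgeConn T 0 x' := by
  rw [← occSet_offEdge, ← mem_wDouble, ← mem_disjOcc_connEvent]
  rfl

/-- The two-arm event without a double connection from the box to `x` is characterised by the
first pivotal edge. -/
lemma twoArm_diff_wDouble_iff {M : ℕ} {B₁ B₂ : Set (Sym2 (Vtx d))} {x x' : Vtx d}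
    {ω : BondConfig d} :
    ω ∈ (specialEvent B₁ B₂ ∩ DisjOcc (ConnEvent 0 x) (ConnEvent 0 x')) \
        WDouble (boxSet d M) x ↔
      ω ∈ specialEvent B₁ B₂ ∩ DisjOcc (ConnEvent 0 x) (ConnEvent 0 x') ∧
        ∃ u v, FirstPivotal (occSet ω) (boxSet d M) u v x := by
  rw [Set.mem_sdiff, mem_wDouble]
  refine and_congr_right fun h => ⟨fun h' => ?_, fun ⟨u, v, h'⟩ => h'.not_doublyReaches⟩
  obtain ⟨S, hS, -, -, -, h0x, -⟩ := mem_disjOcc_connEvent.1 h.2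
  exact (doublyReaches_or_firstPivotal ⟨0, zero_mem_boxSet M, h0x.mono hS⟩).resolve_left h'

lemma FirstPivotal.not_mem_boxEdges {M : ℕ} {G : Set (Sym2 (Vtx d))} {u v x : Vtx d}
    (h : FirstPivotal G (boxSet d M) u v x) : s(u, v) ∉ boxEdges d M :=
  fun he => h.2.2.2.1 (reaches_of_mem _ (he.2 v (Sym2.mem_mk_right _ _)))

lemma twoArm_and_firstPivotal_iff {M : ℕ} {B₁ B₂ : Set (Sym2 (Vtx d))} {u v x x' : Vtx d}
    {ω : BondConfig d} :
    (ω ∈ specialEvent B₁ B₂ ∩ DisjOcc (ConnEvent 0 x) (ConnEvent 0 x') ∧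
        FirstPivotal (occSet ω) (boxSet d M) u v x) ↔
      u ≠ v ∧ ω s(u, v) = true ∧ ω ∈ tildeE M B₁ B₂ u v x' ∧
        ConnIn ω (Ctilde M u v ω)ᶜ v x := by
  rw [Set.mem_inter_iff, mem_disjOcc_connEvent, mem_tildeE, connIn_compl_iff, cTilde_eq]
  constructor
  · rintro ⟨⟨hF, h⟩, hp⟩
    exact ⟨hp.1, hp.2.1, ⟨hF, hp.2.2.1, (hp.twoArm_iff (zero_mem_boxSet M) x').1 h⟩, hp.2.2.2⟩
  · rintro ⟨hne, he, ⟨hF, hu, h⟩, hv⟩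
    have hp : FirstPivotal (occSet ω) (boxSet d M) u v x := ⟨hne, he, hu, hv⟩
    exact ⟨⟨hF, (hp.twoArm_iff (zero_mem_boxSet M) x').2 h⟩, hp⟩

/-! ### Events determined by the edges touching the cluster -/

lemma clusterWithout_congr {G G' : Set (Sym2 (Vtx d))} {W : Set (Vtx d)} {u v : Vtx d}
    (h : ∀ e ∈ touching (clusterWithout G W u v) \ {s(u, v)}, e ∈ G ↔ e ∈ G') :
    clusterWithout G' W u v = clusterWithout G W u v := by
  ext y
  constructor
  · rintro ⟨w, hw, hwy⟩
    exact (hwy.of_closed (C := clusterWithout G W u v) (reaches_of_mem _ hw)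
      fun b hb c hne he => Reaches.snoc hb hne
        ⟨(h _ ⟨⟨b, Sym2.mem_mk_left _ _, hb⟩, he.2⟩).2 he.1, he.2⟩).1
  · rintro ⟨w, hw, hwy⟩
    refine ⟨w, hw, (hwy.of_closed (C := clusterWithout G W u v) (reaches_of_mem _ hw)
      fun b hb c hne he => Reaches.snoc hb hne he).2.mono ?_⟩
    rintro e ⟨he, heC⟩
    refine ⟨(h e ⟨?_, he.2⟩).1 he.1, he.2⟩
    induction e using Sym2.ind with
    | _ b c => exact ⟨b, Sym2.mem_mk_left _ _, heC b (Sym2.mem_mk_left _ _)⟩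

/-- The event `Ẽ(F; u, v, x')` together with `C̃₀ = A`. -/
def tildeECluster (M : ℕ) (B₁ B₂ : Set (Sym2 (Vtx d))) (u v x' : Vtx d) (A : Set (Vtx d)) :
    Set (BondConfig d) :=
  tildeE M B₁ B₂ u v x' ∩ {ω | Ctilde M u v ω = A}

lemma tildeECluster_of_agree {M : ℕ} {B₁ B₂ : Set (Sym2 (Vtx d))}
    (hB : B₁ ∪ B₂ ⊆ boxEdges d M) {u v x' : Vtx d} (huv : s(u, v) ∉ boxEdges d M)
    {A : Set (Vtx d)} {ω ω' : BondConfig d} (h : ∀ e ∈ touching A \ {s(u, v)}, ω e = ω' e)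
    (hω : ω ∈ tildeECluster M B₁ B₂ u v x' A) : ω' ∈ tildeECluster M B₁ B₂ u v x' A := by
  obtain ⟨hE, rfl⟩ := hω
  rw [mem_tildeE] at hE
  obtain ⟨hF, ⟨S, hS, T, hT, hST, hSu, hTu⟩, S', hS', T', hT', hST', hSu', hTx'⟩ := hE
  rw [cTilde_eq] at h
  have hW : boxSet d M ⊆ clusterWithout (occSet ω) (boxSet d M) u v :=
    fun w hw => reaches_of_mem _ hw
  have hbox : ∀ e ∈ boxEdges d M, ω e = ω' e := by
    intro e he
    refine h e ⟨?_, fun heq => huv (heq ▸ he)⟩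
    induction e using Sym2.ind with
    | _ b c =>
      exact ⟨b, Sym2.mem_mk_left _ _, hW (he.2 b (Sym2.mem_mk_left _ _))⟩
  have hcl : clusterWithout (occSet ω') (boxSet d M) u v =
      clusterWithout (occSet ω) (boxSet d M) u v := by
    refine clusterWithout_congr fun e he => ?_
    simp only [occSet, Set.mem_ofPred_eq, h e he]
  set A := clusterWithout (occSet ω) (boxSet d M) u v with hA
  have hin : ∀ {U : Set (Sym2 (Vtx d))}, U ⊆ occSet ω \ {s(u, v)} →
      U ∩ {e | ∀ t ∈ e, t ∈ A} ⊆ occSet ω' \ {s(u, v)} := by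
    rintro U hU e ⟨heU, heA⟩
    refine ⟨?_, (hU heU).2⟩
    have : e ∈ touching A := by
      induction e using Sym2.ind with
      | _ b c => exact ⟨b, Sym2.mem_mk_left _ _, heA b (Sym2.mem_mk_left _ _)⟩
    exact (h e ⟨this, (hU heU).2⟩).symm.trans (hU heU).1
  have hconn : ∀ {U : Set (Sym2 (Vtx d))}, U ⊆ occSet ω \ {s(u, v)} → ∀ {w y : Vtx d},
      w ∈ boxSet d M → EdgeConn U w y → EdgeConn (U ∩ {e | ∀ t ∈ e, t ∈ A}) w y :=
    fun hU w y hw hwy => (hwy.of_closed (C := A) (hW hw)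
      fun b hb c hne he => Reaches.snoc hb hne (hU he)).2
  have hreach : ∀ {U : Set (Sym2 (Vtx d))}, U ⊆ occSet ω \ {s(u, v)} →
      Reaches U (boxSet d M) u → Reaches (U ∩ {e | ∀ t ∈ e, t ∈ A}) (boxSet d M) u :=
    fun hU ⟨w, hw, hwu⟩ => ⟨w, hw, hconn hU hw hwu⟩
  have h0 := zero_mem_boxSet (d := d) M
  refine ⟨mem_tildeE.2 ⟨⟨fun e he => ?_, fun e he => ?_⟩,
    ⟨_, hin hS, _, hin hT, hST.mono Set.inter_subset_left Set.inter_subset_left,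
      hreach hS hSu, hreach hT hTu⟩,
    _, hin hS', _, hin hT', hST'.mono Set.inter_subset_left Set.inter_subset_left,
      hconn hS' h0 hSu', hconn hT' h0 hTx'⟩, ?_⟩
  · rw [← hbox e (hB (Or.inl he)), hF.1 e he]
  · rw [← hbox e (hB (Or.inr he)), hF.2 e he]
  · rw [Set.mem_ofPred_eq, cTilde_eq, cTilde_eq, hcl]

lemma mem_of_mem_tildeECluster {M : ℕ} {B₁ B₂ : Set (Sym2 (Vtx d))} {u v x' : Vtx d}
    {A : Set (Vtx d)} {ω : BondConfig d} (hω : ω ∈ tildeECluster M B₁ B₂ u v x' A) : u ∈ A := by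
  obtain ⟨hE, rfl⟩ := hω
  rw [cTilde_eq]
  exact (mem_tildeE.1 hE).2.1.reaches

lemma cTilde_finite {M : ℕ} {u v : Vtx d} {ω : BondConfig d}
    (h : ∀ a : Vtx d, {b : Vtx d | Conn ω a b}.Finite) : (Ctilde M u v ω).Finite := by
  refine ((boxSet_finite M).biUnion fun w _ => h w).subset ?_
  rw [cTilde_eq]
  rintro y ⟨w, hw, hwy⟩
  exact Set.mem_biUnion hw (hwy.mono Set.sdiff_subset)

end Events

/-! ### Measurability and independence -/

section Measure

open ProbabilityTheory

variable {d : ℕ}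

/-- The σ-algebra generated by the states of the edges of `T`. -/
abbrev edgeSigma (T : Set (Sym2 (Vtx d))) : MeasurableSpace (BondConfig d) :=
  ⨆ e ∈ T, MeasurableSpace.comap (fun ω : BondConfig d => ω e) inferInstance

lemma measurable_edgeSigma {T : Set (Sym2 (Vtx d))} {e : Sym2 (Vtx d)} (he : e ∈ T) :
    Measurable[edgeSigma T] fun ω : BondConfig d => ω e := by
  rw [measurable_iff_comap_le]
  exact le_iSup₂_of_le e he le_rfl

lemma measurable_restrictTo_edgeSigma (T : Set (Sym2 (Vtx d))) :
    Measurable[edgeSigma T] (restrictTo T) := by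
  refine @measurable_pi_lambda _ _ _ (edgeSigma T) _ _ fun e => ?_
  by_cases he : e ∈ T
  · simpa only [restrictTo, if_pos he] using measurable_edgeSigma he
  · simpa only [restrictTo, if_neg he] using @measurable_const _ _ _ (edgeSigma T) _

lemma measurable_restrictTo (T : Set (Sym2 (Vtx d))) : Measurable (restrictTo T) := by
  refine measurable_pi_lambda _ fun e => ?_
  by_cases he : e ∈ T
  · simpa only [restrictTo, if_pos he] using measurable_pi_apply e
  · simpa only [restrictTo, if_neg he] using measurable_const

/-- A measurable event that depends only on the edges of `T` belongs to their σ-algebra. -/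
lemma measurableSet_edgeSigma {T : Set (Sym2 (Vtx d))} {E : Set (BondConfig d)}
    (hE : MeasurableSet E)
    (h : ∀ ω ω' : BondConfig d, (∀ e ∈ T, ω e = ω' e) → ω ∈ E → ω' ∈ E) :
    MeasurableSet[edgeSigma T] E := by
  have : E = restrictTo T ⁻¹' E := by
    ext ω
    have hr : ∀ e ∈ T, restrictTo T ω e = ω e := fun e he => if_pos he
    exact ⟨h _ _ fun e he => (hr e he).symm, h _ _ hr⟩
  rw [this]
  exact measurable_restrictTo_edgeSigma T hE

lemma measurableSet_edge (e : Sym2 (Vtx d)) (b : Bool) :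
    MeasurableSet {ω : BondConfig d | ω e = b} :=
  measurableSet_eq_fun (measurable_pi_apply e) measurable_const

lemma measurableSet_subset_occSet (S : Set (Sym2 (Vtx d))) :
    MeasurableSet {ω : BondConfig d | S ⊆ occSet ω} := by
  have : {ω : BondConfig d | S ⊆ occSet ω} = ⋂ e ∈ S, {ω | ω e = true} := by
    ext ω
    simp [Set.subset_def, occSet]
  rw [this]
  exact MeasurableSet.biInter (Set.to_countable S) fun e _ => measurableSet_edge e true

lemma measurableSet_disjOcc_connEvent (a b a' b' : Vtx d) :
    MeasurableSet (DisjOcc (ConnEvent a b) (ConnEvent a' b')) := by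
  have : DisjOcc (ConnEvent a b) (ConnEvent a' b') =
      ⋃ (s : Finset (Sym2 (Vtx d))) (t : Finset (Sym2 (Vtx d)))
        (_ : Disjoint (s : Set (Sym2 (Vtx d))) t ∧ EdgeConn (s : Set (Sym2 (Vtx d))) a b ∧
          EdgeConn (t : Set (Sym2 (Vtx d))) a' b'),
        {ω : BondConfig d | (s : Set (Sym2 (Vtx d))) ⊆ occSet ω} ∩
          {ω | (t : Set (Sym2 (Vtx d))) ⊆ occSet ω} := by
    ext ω
    simp only [mem_disjOcc_connEvent, Set.mem_iUnion]
    constructor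
    · rintro ⟨S, hS, T, hT, hST, hab, hab'⟩
      obtain ⟨s, hs, hab⟩ := hab.exists_finset
      obtain ⟨t, ht, hab'⟩ := hab'.exists_finset
      exact ⟨s, t, ⟨hST.mono hs ht, hab, hab'⟩, hs.trans hS, ht.trans hT⟩
    · rintro ⟨s, t, ⟨hst, hab, hab'⟩, hs, ht⟩
      exact ⟨s, hs, t, ht, hst, hab, hab'⟩
  rw [this]
  exact MeasurableSet.iUnion fun s => MeasurableSet.iUnion fun t => MeasurableSet.iUnion fun _ =>
    (measurableSet_subset_occSet _).inter (measurableSet_subset_occSet _)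

lemma measurableSet_connEvent (a b : Vtx d) : MeasurableSet (ConnEvent a b) := by
  have : ConnEvent a b = DisjOcc (ConnEvent a b) (ConnEvent a a) := by
    ext ω
    rw [mem_disjOcc_connEvent]
    exact ⟨fun h => ⟨_, subset_rfl, ∅, Set.empty_subset _, disjoint_bot_right, h,
      Relation.ReflTransGen.refl⟩, fun ⟨_, hS, _, _, _, h, _⟩ => h.mono hS⟩
  rw [this]
  exact measurableSet_disjOcc_connEvent _ _ _ _

lemma measurableSet_wDouble (W : Set (Vtx d)) (u : Vtx d) : MeasurableSet (WDouble W u) :=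
  MeasurableSet.biUnion (Set.to_countable W) fun _ _ =>
    MeasurableSet.biUnion (Set.to_countable W) fun _ _ => measurableSet_disjOcc_connEvent _ _ _ _

lemma measurableSet_specialEvent (B₁ B₂ : Set (Sym2 (Vtx d))) :
    MeasurableSet (specialEvent B₁ B₂) := by
  have : specialEvent B₁ B₂ =
      (⋂ e ∈ B₁, {ω : BondConfig d | ω e = true}) ∩ ⋂ e ∈ B₂, {ω | ω e = false} := by
    ext ω
    simp [specialEvent]
  rw [this]
  exact (MeasurableSet.biInter (Set.to_countable _) fun e _ => measurableSet_edge e _).inter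
    (MeasurableSet.biInter (Set.to_countable _) fun e _ => measurableSet_edge e _)

lemma measurable_offEdge (e : Sym2 (Vtx d)) :
    Measurable fun ω : BondConfig d => offEdge ω e := by
  simp only [offEdge_eq_restrictTo]
  exact measurable_restrictTo _

lemma measurableSet_tildeE (M : ℕ) (B₁ B₂ : Set (Sym2 (Vtx d))) (u v x' : Vtx d) :
    MeasurableSet (tildeE M B₁ B₂ u v x') :=
  (measurableSet_specialEvent B₁ B₂).inter <| measurable_offEdge s(u, v) <|
    (measurableSet_wDouble _ _).inter (measurableSet_disjOcc_connEvent _ _ _ _)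

lemma measurableSet_cTilde_eq (M : ℕ) (u v : Vtx d) (A : Set (Vtx d)) :
    MeasurableSet {ω : BondConfig d | Ctilde M u v ω = A} := by
  have hmem : ∀ y, MeasurableSet {ω : BondConfig d | y ∈ Ctilde M u v ω} := by
    intro y
    have : {ω : BondConfig d | y ∈ Ctilde M u v ω} =
        ⋃ w ∈ boxSet d M, (fun ω => offEdge ω s(u, v)) ⁻¹' ConnEvent w y := by
      ext ω
      simp [Ctilde, ConnEvent]
    rw [this]
    exact MeasurableSet.biUnion (Set.to_countable _) fun w _ =>
      measurable_offEdge _ (measurableSet_connEvent w y)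
  have : {ω : BondConfig d | Ctilde M u v ω = A} =
      ⋂ y, {ω : BondConfig d | y ∈ Ctilde M u v ω ↔ y ∈ A} := by
    ext ω
    simp [Set.ext_iff]
  rw [this]
  exact MeasurableSet.iInter fun y => (hmem y).iff (MeasurableSet.const _)

lemma measurableSet_tildeECluster (M : ℕ) (B₁ B₂ : Set (Sym2 (Vtx d))) (u v x' : Vtx d)
    (A : Set (Vtx d)) : MeasurableSet (tildeECluster M B₁ B₂ u v x' A) :=
  (measurableSet_tildeE M B₁ B₂ u v x').inter (measurableSet_cTilde_eq M u v A)

lemma measurableSet_connIn_edgeSigma (A : Set (Vtx d)) (v x : Vtx d) :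
    MeasurableSet[edgeSigma (avoiding A)] {ω : BondConfig d | ConnIn ω Aᶜ v x} := by
  by_cases hv : v ∈ A
  · have : {ω : BondConfig d | ConnIn ω Aᶜ v x} = ∅ := by
      ext ω
      simp [connIn_compl_iff, hv]
    rw [this]
    exact @MeasurableSet.empty _ (edgeSigma _)
  · have : {ω : BondConfig d | ConnIn ω Aᶜ v x} = restrictTo (avoiding A) ⁻¹' ConnEvent v x := by
      ext ω
      rw [Set.mem_ofPred_eq, connIn_compl_iff, Set.mem_preimage, mem_connEvent, occSet_restrictTo]
      exact and_iff_right hv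
    rw [this]
    exact measurable_restrictTo_edgeSigma _ (measurableSet_connEvent v x)

lemma edgeSigma_le (T : Set (Sym2 (Vtx d))) : edgeSigma T ≤ MeasurableSpace.pi :=
  iSup₂_le fun e _ => (measurable_pi_apply e).comap_le

lemma edgeSigma_mono {S T : Set (Sym2 (Vtx d))} (h : S ⊆ T) : edgeSigma S ≤ edgeSigma T :=
  biSup_mono fun _ he => h he

lemma IsBernoulli.measure_edge {P : Measure (BondConfig d)} {p : ℝ} {D : Vtx d → ℝ}
    (hP : IsBernoulli P p D) (e : Sym2 (Vtx d)) :
    P {ω | ω e = true} = ENNReal.ofReal (edgeProb p D e) := by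
  simpa using hP.2 {e} fun _ => true

lemma IsBernoulli.iIndep_edges {P : Measure (BondConfig d)} {p : ℝ} {D : Vtx d → ℝ}
    (hP : IsBernoulli P p D) :
    iIndep (fun e : Sym2 (Vtx d) =>
      MeasurableSpace.comap (fun ω : BondConfig d => ω e) inferInstance) P := by
  refine iIndepSets.iIndep (fun e => (measurable_pi_apply e).comap_le)
    (fun e => {{ω : BondConfig d | ω e = true}}) (fun e => IsPiSystem.singleton _) ?_ ?_
  · intro e
    refine le_antisymm ?_ (MeasurableSpace.generateFrom_le ?_)
    · rw [← measurable_iff_comap_le]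
      have hm : MeasurableSet[MeasurableSpace.generateFrom {{ω : BondConfig d | ω e = true}}]
          {ω : BondConfig d | ω e = true} := MeasurableSpace.measurableSet_generateFrom rfl
      exact @measurable_to_bool _ (MeasurableSpace.generateFrom _) _ hm
    · rintro _ rfl
      exact ⟨{true}, measurableSet_singleton _, rfl⟩
  · rw [iIndepSets_iff]
    intro s f hf
    have h1 : ∀ e ∈ s, f e = {ω : BondConfig d | ω e = true} := hf
    have h2 : ⋂ e ∈ s, f e = {ω : BondConfig d | ∀ e ∈ s, ω e = true} := by
      ext ω
      simp only [Set.mem_iInter, Set.mem_ofPred_eq]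
      refine forall₂_congr fun e he => ?_
      rw [h1 e he, Set.mem_ofPred_eq]
    rw [h2, hP.2 s fun _ => true]
    refine Finset.prod_congr rfl fun e he => ?_
    rw [h1 e he, hP.measure_edge, if_pos rfl]

lemma IsBernoulli.measure_inter {P : Measure (BondConfig d)} {p : ℝ} {D : Vtx d → ℝ}
    (hP : IsBernoulli P p D) {S T : Set (Sym2 (Vtx d))} (hST : Disjoint S T)
    {E G : Set (BondConfig d)} (hE : MeasurableSet[edgeSigma S] E)
    (hG : MeasurableSet[edgeSigma T] G) : P (E ∩ G) = P E * P G :=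
  (Indep_iff _ _ _).1 (indep_iSup_of_disjoint (fun e => (measurable_pi_apply e).comap_le)
    hP.iIndep_edges hST) E G hE hG

lemma measure_tildeECluster_inter {p : ℝ} {D : Vtx d → ℝ} (hDsymm : ∀ z, D (-z) = D z)
    {P : Measure (BondConfig d)} (hP : IsBernoulli P p D) {M : ℕ} {B₁ B₂ : Set (Sym2 (Vtx d))}
    (hB : B₁ ∪ B₂ ⊆ boxEdges d M) {u v : Vtx d} (huv : s(u, v) ∉ boxEdges d M) (x x' : Vtx d)
    (A : Set (Vtx d)) :
    P (tildeECluster M B₁ B₂ u v x' A ∩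
        ({ω | ω s(u, v) = true} ∩ {ω | ConnIn ω Aᶜ v x})) =
      ENNReal.ofReal (p * D (v - u)) *
        (P {ω | ConnIn ω Aᶜ v x} * P (tildeECluster M B₁ B₂ u v x' A)) := by
  by_cases hu : u ∈ A
  · have hedge : MeasurableSet[edgeSigma {s(u, v)}] {ω : BondConfig d | ω s(u, v) = true} :=
      measurable_edgeSigma (Set.mem_singleton _) (measurableSet_singleton true)
    have havoid : s(u, v) ∉ avoiding A := fun h => h u (Sym2.mem_mk_left _ _) hu
    have hprob : edgeProb p D s(u, v) = p * D (v - u) := by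
      simp only [edgeProb, Sym2.lift_mk]
      rw [← neg_sub v u, hDsymm]
      ring
    rw [hP.measure_inter (S := touching A \ {s(u, v)}) (T := {s(u, v)} ∪ avoiding A) ?_
      (measurableSet_edgeSigma (measurableSet_tildeECluster _ _ _ _ _ _ _)
        fun ω ω' h => tildeECluster_of_agree hB huv h)
      (MeasurableSet.inter (edgeSigma_mono Set.subset_union_left _ hedge)
        (edgeSigma_mono Set.subset_union_right _ (measurableSet_connIn_edgeSigma A v x))),
      hP.measure_inter (Set.disjoint_singleton_left.2 havoid) hedge
        (measurableSet_connIn_edgeSigma A v x), hP.measure_edge, hprob]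
    · ring
    · rw [Set.disjoint_left]
      rintro e ⟨⟨t, ht, htA⟩, he⟩ (he' | he')
      exacts [he he', he' t ht htA]
  · have : tildeECluster M B₁ B₂ u v x' A = ∅ :=
      Set.eq_empty_of_forall_notMem fun ω hω => hu (mem_of_mem_tildeECluster hω)
    simp [this]

/-- Up to a null event, `C̃₀` is one of the countably many finite sets. -/
lemma tildeE_ae_eq_iUnion {P : Measure (BondConfig d)}
    (hfin : ∀ᵐ ω ∂P, ∀ a : Vtx d, {b : Vtx d | Conn ω a b}.Finite) (M : ℕ)
    (B₁ B₂ : Set (Sym2 (Vtx d))) (u v x' : Vtx d) :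
    tildeE M B₁ B₂ u v x' =ᵐ[P]
      ⋃ A : Finset (Vtx d), tildeECluster M B₁ B₂ u v x' (A : Set (Vtx d)) := by
  rw [Filter.eventuallyEq_set]
  filter_upwards [hfin] with ω hω
  simp only [Set.mem_iUnion]
  exact ⟨fun h => ⟨(cTilde_finite hω).toFinset, h, (Set.Finite.coe_toFinset _).symm⟩,
    fun ⟨_, h⟩ => h.1⟩

lemma lintegral_tildeE {P : Measure (BondConfig d)}
    (hfin : ∀ᵐ ω ∂P, ∀ a : Vtx d, {b : Vtx d | Conn ω a b}.Finite) (M : ℕ)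
    (B₁ B₂ : Set (Sym2 (Vtx d))) (u v x' : Vtx d) (f : Set (Vtx d) → ℝ≥0∞) :
    ∫⁻ ω in tildeE M B₁ B₂ u v x', f (Ctilde M u v ω) ∂P =
      ∑' A : Finset (Vtx d), f A * P (tildeECluster M B₁ B₂ u v x' A) := by
  rw [setLIntegral_congr (tildeE_ae_eq_iUnion hfin M B₁ B₂ u v x'),
    lintegral_iUnion (fun A => measurableSet_tildeECluster _ _ _ _ _ _ _)]
  · refine tsum_congr fun A => ?_
    rw [← setLIntegral_const]
    exact setLIntegral_congr_fun (measurableSet_tildeECluster _ _ _ _ _ _ _)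
      fun ω hω => congrArg f hω.2
  · intro A A' hne
    refine Set.disjoint_left.2 fun ω h h' => hne ?_
    exact Finset.coe_injective (h.2.symm.trans h'.2)

/-- The event that `{u, v}` is the first pivotal edge and that `C̃₀ = A`. -/
def pivotalPiece (M : ℕ) (B₁ B₂ : Set (Sym2 (Vtx d))) (x x' : Vtx d)
    (i : (Vtx d × Vtx d) × Finset (Vtx d)) : Set (BondConfig d) :=
  {ω | (i.1.1 ≠ i.1.2 ∧ s(i.1.1, i.1.2) ∉ boxEdges d M) ∧
    ω ∈ tildeECluster M B₁ B₂ i.1.1 i.1.2 x' i.2 ∩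
      ({ω | ω s(i.1.1, i.1.2) = true} ∩ {ω | ConnIn ω (i.2 : Set (Vtx d))ᶜ i.1.2 x})}

lemma mem_pivotalPiece {M : ℕ} {B₁ B₂ : Set (Sym2 (Vtx d))} {x x' : Vtx d}
    {i : (Vtx d × Vtx d) × Finset (Vtx d)} {ω : BondConfig d} :
    ω ∈ pivotalPiece M B₁ B₂ x x' i ↔
      (ω ∈ specialEvent B₁ B₂ ∩ DisjOcc (ConnEvent 0 x) (ConnEvent 0 x') ∧
        FirstPivotal (occSet ω) (boxSet d M) i.1.1 i.1.2 x) ∧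
      Ctilde M i.1.1 i.1.2 ω = i.2 := by
  obtain ⟨⟨u, v⟩, A⟩ := i
  constructor
  · rintro ⟨h, ⟨hE, hA⟩, he, hc⟩
    rw [Set.mem_ofPred_eq] at hA
    exact ⟨twoArm_and_firstPivotal_iff.2 ⟨h.1, he, hE, by rw [hA]; exact hc⟩, hA⟩
  · rintro ⟨h, hA⟩
    obtain ⟨hne, he, hE, hc⟩ := twoArm_and_firstPivotal_iff.1 h
    exact ⟨⟨hne, h.2.not_mem_boxEdges⟩, ⟨hE, hA⟩, he, by rwa [← hA]⟩

lemma measurableSet_pivotalPiece (M : ℕ) (B₁ B₂ : Set (Sym2 (Vtx d))) (x x' : Vtx d)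
    (i : (Vtx d × Vtx d) × Finset (Vtx d)) : MeasurableSet (pivotalPiece M B₁ B₂ x x' i) :=
  (MeasurableSet.const _).inter <| (measurableSet_tildeECluster _ _ _ _ _ _ _).inter <|
    (measurableSet_edge _ _).inter (edgeSigma_le _ _ (measurableSet_connIn_edgeSigma _ _ _))

lemma pairwise_disjoint_pivotalPiece (M : ℕ) (B₁ B₂ : Set (Sym2 (Vtx d))) (x x' : Vtx d) :
    Pairwise (Function.onFun Disjoint (pivotalPiece M B₁ B₂ x x')) := by
  rintro ⟨⟨u, v⟩, A⟩ ⟨⟨u', v'⟩, A'⟩ hne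
  refine Set.disjoint_left.2 fun ω h h' => hne ?_
  rw [mem_pivotalPiece] at h h'
  obtain ⟨hu, hv⟩ : u = u' ∧ v = v' := h.1.2.unique h'.1.2
  subst hu hv
  have hA := Finset.coe_injective (h.2.symm.trans h'.2)
  exact congrArg _ hA

lemma twoArm_diff_wDouble_ae_eq {P : Measure (BondConfig d)}
    (hfin : ∀ᵐ ω ∂P, ∀ a : Vtx d, {b : Vtx d | Conn ω a b}.Finite) (M : ℕ)
    (B₁ B₂ : Set (Sym2 (Vtx d))) (x x' : Vtx d) :
    ((specialEvent B₁ B₂ ∩ DisjOcc (ConnEvent 0 x) (ConnEvent 0 x')) \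
        WDouble (boxSet d M) x : Set (BondConfig d)) =ᵐ[P] ⋃ i, pivotalPiece M B₁ B₂ x x' i := by
  rw [Filter.eventuallyEq_set]
  filter_upwards [hfin] with ω hω
  simp only [twoArm_diff_wDouble_iff, Set.mem_iUnion, mem_pivotalPiece]
  exact ⟨fun ⟨h, u, v, h'⟩ => ⟨((u, v), (cTilde_finite hω).toFinset), ⟨h, h'⟩,
    (Set.Finite.coe_toFinset _).symm⟩, fun ⟨i, h, _⟩ => ⟨h.1, _, _, h.2⟩⟩

lemma tsum_measure_pivotalPiece {p : ℝ} {D : Vtx d → ℝ} (hDsymm : ∀ z, D (-z) = D z)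
    {P : Measure (BondConfig d)} (hP : IsBernoulli P p D)
    (hfin : ∀ᵐ ω ∂P, ∀ a : Vtx d, {b : Vtx d | Conn ω a b}.Finite) {M : ℕ}
    {B₁ B₂ : Set (Sym2 (Vtx d))} (hB : B₁ ∪ B₂ ⊆ boxEdges d M) (x x' : Vtx d)
    (uv : Vtx d × Vtx d) :
    ∑' A : Finset (Vtx d), P (pivotalPiece M B₁ B₂ x x' (uv, A)) =
      if uv.1 ≠ uv.2 ∧ s(uv.1, uv.2) ∉ boxEdges d M then
        ENNReal.ofReal (p * D (uv.2 - uv.1)) *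
          ∫⁻ ω in tildeE M B₁ B₂ uv.1 uv.2 x',
            P {ω' : BondConfig d | ConnIn ω' (Ctilde M uv.1 uv.2 ω)ᶜ uv.2 x} ∂P
      else 0 := by
  split_ifs with h
  · rw [lintegral_tildeE hfin M B₁ B₂ uv.1 uv.2 x'
      (fun A => P {ω' : BondConfig d | ConnIn ω' Aᶜ uv.2 x}), ← ENNReal.tsum_mul_left]
    refine tsum_congr fun A => ?_
    rw [← measure_tildeECluster_inter hDsymm hP hB h.2]
    congr 1
    ext ω
    exact and_iff_right h
  · refine ENNReal.tsum_eq_zero.2 fun A => ?_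
    have : pivotalPiece M B₁ B₂ x x' (uv, A) = ∅ :=
      Set.eq_empty_of_forall_notMem fun ω hω => h hω.1
    rw [this, measure_empty]

end Measure

/-- **First-pivotal-bond decomposition** (Lemma 2.2).
At a parameter `p` where almost surely all clusters are finite, the probability of
`F ∩ ({o ↔ x} ∘ {o ↔ x'})` decomposes as the probability that moreover `W ⇔ x`,
plus a sum over the possible first pivotal bonds `(u₀, v₀)` for `W ↔ x` of
`p D(v₀ − u₀)` times the expectation over `Ẽ(F; u₀, v₀, x')` of the restricted
two-point function `τ^{C̃₀}(v₀, x)`. -/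
theorem first_pivotal_decomposition
    (d : ℕ) (p : ℝ) (hp0 : 0 ≤ p) (hp1 : p ≤ 1)
    (D : Vtx d → ℝ)
    (hD0 : D 0 = 0)
    (hDrange : ∀ z, 0 ≤ D z ∧ D z ≤ 1)
    (hDsymm : ∀ z, D (-z) = D z)
    (hDperm : ∀ (σ : Equiv.Perm (Fin d)) (z : Vtx d), D (fun i => z (σ i)) = D z)
    (hDsign : ∀ (ε : Fin d → Bool) (z : Vtx d),
      D (fun i => if ε i then -z i else z i) = D z)
    (hDsum : HasSum D 1)
    (P : Measure (BondConfig d)) (hP : IsBernoulli P p D)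
    (hfin : ∀ᵐ ω ∂P, ∀ a : Vtx d, {b : Vtx d | Conn ω a b}.Finite)
    (M : ℕ) (hM : 1 ≤ M)
    (B₁ B₂ : Set (Sym2 (Vtx d)))
    (hBunion : B₁ ∪ B₂ = boxEdges d M) (hBdisj : Disjoint B₁ B₂)
    (x x' : Vtx d) (hxx' : x ≠ x')
    (hx : x ∉ boxSet d M) (hx' : x' ∉ boxSet d M) :
    P (specialEvent B₁ B₂ ∩ DisjOcc (ConnEvent 0 x) (ConnEvent 0 x')) =
      P (specialEvent B₁ B₂ ∩ WDouble (boxSet d M) x ∩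
          DisjOcc (ConnEvent 0 x) (ConnEvent 0 x')) +
        ∑' uv : Vtx d × Vtx d,
          (if uv.1 ≠ uv.2 ∧ s(uv.1, uv.2) ∉ boxEdges d M then
            ENNReal.ofReal (p * D (uv.2 - uv.1)) *
              ∫⁻ ω in tildeE M B₁ B₂ uv.1 uv.2 x',
                P {ω' : BondConfig d | ConnIn ω' (Ctilde M uv.1 uv.2 ω)ᶜ uv.2 x} ∂P
          else 0) := by
  rw [← measure_inter_add_sdiff _ (measurableSet_wDouble (boxSet d M) x),
    Set.inter_right_comm, measure_congr (twoArm_diff_wDouble_ae_eq hfin M B₁ B₂ x x'),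
    measure_iUnion (pairwise_disjoint_pivotalPiece M B₁ B₂ x x')
      (measurableSet_pivotalPiece M B₁ B₂ x x'), ENNReal.tsum_prod']
  congr 1
  exact tsum_congr fun uv => tsum_measure_pivotalPiece hDsymm hP hfin hBunion.subset x x' uv
end

section
/- Existence of strongly H-reducible edges (Proposition 4.7). Let G be a finite connected simple graph and S ⊆ V(G) with |S| = 3. Assume G is 3-connected to S, every vertex in V(G) ∖ S has degree 3, and every vertex in S has degree at most 2. If V(G) ∖ S contains two adjacent vertices, then G contains a strongly H-reducible edge (i.e., an edge {x,y} with x, y ∈ V(G) ∖ S which is H-reducible and whose H-reduction leaves the graph 3-connected to S). -/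
open scoped Classical

/-- A finite multigraph on a vertex type `V`: a finite vertex set together with
an edge-multiplicity function on unordered pairs, supported on pairs of vertices. -/
structure Multigraph (V : Type) where
  verts : Finset V
  mult : Sym2 V → ℕ
  supp : ∀ e : Sym2 V, mult e ≠ 0 → ∀ v ∈ e, v ∈ verts

namespace Multigraph

variable {V : Type}

/-- The multiset of neighbours of `x`, counted with edge multiplicity. -/
def nbrs (G : Multigraph V) (x : V) : Multiset V :=
  G.verts.val.bind fun u => Multiset.replicate (G.mult s(x, u)) u

/-- The (edge-)degree of a vertex: the number of edges incident to it. -/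
def deg (G : Multigraph V) (x : V) : ℕ := (G.nbrs x).card

/-- Adjacency: `a ≠ b` and at least one edge joins `a` and `b`. -/
def Adj (G : Multigraph V) (a b : V) : Prop := a ≠ b ∧ G.mult s(a, b) ≠ 0

/-- A multigraph is simple if all multiplicities are at most one and there
are no self-loops. -/
def IsSimple (G : Multigraph V) : Prop :=
  (∀ e : Sym2 V, G.mult e ≤ 1) ∧ ∀ v : V, G.mult s(v, v) = 0

/-- Connectivity of a multigraph. -/
def Connected (G : Multigraph V) : Prop :=
  G.verts.Nonempty ∧ ∀ u ∈ G.verts, ∀ v ∈ G.verts, Relation.ReflTransGen G.Adj u v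

/-- The number of edges (counted with multiplicity). -/
def numEdges (G : Multigraph V) : ℕ := ∑ e ∈ G.verts.sym2, G.mult e

end Multigraph

/-- The list of (unordered) edges traversed by a list of vertices. -/
def listEdges {V : Type} (l : List V) : List (Sym2 V) :=
  (l.zip l.tail).map fun p => s(p.1, p.2)

namespace Multigraph

variable {V : Type}

/-- `l` is a (simple) path in `G`: a nonempty list of distinct vertices of `G`
in which consecutive vertices are adjacent. -/
def IsPathList (G : Multigraph V) (l : List V) : Prop :=
  l ≠ [] ∧ l.Nodup ∧ (∀ v ∈ l, v ∈ G.verts) ∧ l.Chain' G.Adj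

/-- `l` is a simple path in `G` from `a` to `b`. -/
def IsPathBetween (G : Multigraph V) (a b : V) (l : List V) : Prop :=
  G.IsPathList l ∧ l.head? = some a ∧ l.getLast? = some b

/-- `x` is 3-connected to `{s₁, s₂, s₃}`: there are three pairwise edge-disjoint
paths from `x` to `s₁`, `s₂` and `s₃` respectively. -/
def ThreeConnFrom (G : Multigraph V) (s₁ s₂ s₃ x : V) : Prop :=
  ∃ l₁ l₂ l₃ : List V,
    G.IsPathBetween x s₁ l₁ ∧ G.IsPathBetween x s₂ l₂ ∧ G.IsPathBetween x s₃ l₃ ∧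
    (listEdges l₁).Disjoint (listEdges l₂) ∧
    (listEdges l₁).Disjoint (listEdges l₃) ∧
    (listEdges l₂).Disjoint (listEdges l₃)

/-- `G` is 3-connected to `{s₁, s₂, s₃}`: every vertex outside `{s₁, s₂, s₃}`
is 3-connected to `{s₁, s₂, s₃}`. -/
def ThreeConnTo (G : Multigraph V) (s₁ s₂ s₃ : V) : Prop :=
  ∀ x ∈ G.verts, x ≠ s₁ → x ≠ s₂ → x ≠ s₃ → G.ThreeConnFrom s₁ s₂ s₃ x

/-- The edge `{x, y}` is H-reducible: `x` and `y` both have degree at least 3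
and are joined by exactly one edge. -/
def HReducible (G : Multigraph V) (x y : V) : Prop :=
  x ∈ G.verts ∧ y ∈ G.verts ∧ x ≠ y ∧ G.mult s(x, y) = 1 ∧
    3 ≤ G.deg x ∧ 3 ≤ G.deg y

/-- `G'` is the H-reduction of `G` by the H-reducible edge `{x, y}`:
if `x` (resp. `y`) has degree `3` it is deleted and its two remaining
neighbours get joined by a new edge `e_{x∖y}` (resp. `e_{y∖x}`); a vertex of
degree at least `4` is kept; if both have degree at least `4`, only the edge
`{x, y}` is deleted. -/
def IsHReductionBy (G : Multigraph V) (x y : V) (G' : Multigraph V) : Prop :=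
  G.HReducible x y ∧
    ((G.deg x = 3 ∧ G.deg y = 3 ∧
        ∃ z₁ z₂ t₁ t₂ : V,
          G.nbrs x = {y, z₁, z₂} ∧ G.nbrs y = {x, t₁, t₂} ∧
          (∀ v : V, v ∈ G'.verts ↔ v ∈ G.verts ∧ v ≠ x ∧ v ≠ y) ∧
          ∀ e : Sym2 V, G'.mult e =
            (if x ∈ e ∨ y ∈ e then 0 else G.mult e)
              + (if e = s(z₁, z₂) then 1 else 0)
              + (if e = s(t₁, t₂) then 1 else 0)) ∨
     (G.deg x = 3 ∧ 4 ≤ G.deg y ∧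
        ∃ z₁ z₂ : V, G.nbrs x = {y, z₁, z₂} ∧
          (∀ v : V, v ∈ G'.verts ↔ v ∈ G.verts ∧ v ≠ x) ∧
          ∀ e : Sym2 V, G'.mult e =
            (if x ∈ e then 0 else G.mult e) + (if e = s(z₁, z₂) then 1 else 0)) ∨
     (G.deg y = 3 ∧ 4 ≤ G.deg x ∧
        ∃ t₁ t₂ : V, G.nbrs y = {x, t₁, t₂} ∧
          (∀ v : V, v ∈ G'.verts ↔ v ∈ G.verts ∧ v ≠ y) ∧
          ∀ e : Sym2 V, G'.mult e =
            (if y ∈ e then 0 else G.mult e) + (if e = s(t₁, t₂) then 1 else 0)) ∨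
     (4 ≤ G.deg x ∧ 4 ≤ G.deg y ∧
        (∀ v : V, v ∈ G'.verts ↔ v ∈ G.verts) ∧
        ∀ e : Sym2 V, G'.mult e = if e = s(x, y) then 0 else G.mult e))

end Multigraph

namespace Multigraph

variable {V : Type}

theorem deg_eq_sum (G : Multigraph V) (x : V) :
    G.deg x = ∑ u ∈ G.verts, G.mult s(x, u) := by
  simp only [deg, nbrs, Multiset.card_bind, Function.comp_def, Multiset.card_replicate]
  rfl

theorem count_nbrs (G : Multigraph V) (x u : V) : (G.nbrs x).count u = G.mult s(x, u) := by
  have h : (G.nbrs x).count u = ∑ v ∈ G.verts, if v = u then G.mult s(x, v) else 0 := by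
    simp only [nbrs, Multiset.count_bind, Multiset.count_replicate]
    rfl
  rw [h, Finset.sum_ite_eq']
  split_ifs with hu
  · rfl
  · by_contra hne
    exact hu (G.supp _ (Ne.symm hne) u (by simp))

theorem Adj.symm {G : Multigraph V} {a b : V} (h : G.Adj a b) : G.Adj b a :=
  ⟨h.1.symm, by rw [Sym2.eq_swap]; exact h.2⟩

theorem Adj.left_mem {G : Multigraph V} {a b : V} (h : G.Adj a b) : a ∈ G.verts :=
  G.supp _ h.2 a (by simp)

/-- The number of edges between two disjoint vertex sets, counted with multiplicity. -/
noncomputable def cut (G : Multigraph V) (A B : Finset V) : ℕ :=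
  ∑ u ∈ A, ∑ v ∈ B, G.mult s(u, v)

theorem cut_comm (G : Multigraph V) (A B : Finset V) : G.cut A B = G.cut B A := by
  unfold cut
  rw [Finset.sum_comm]
  simp only [Sym2.eq_swap]

theorem cut_union_left (G : Multigraph V) {A B : Finset V} (C : Finset V) (h : Disjoint A B) :
    G.cut (A ∪ B) C = G.cut A C + G.cut B C :=
  Finset.sum_union h

theorem cut_union_right (G : Multigraph V) (A : Finset V) {B C : Finset V} (h : Disjoint B C) :
    G.cut A (B ∪ C) = G.cut A B + G.cut A C := by
  rw [cut_comm, cut_union_left _ _ h, cut_comm, G.cut_comm C]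

/-- The number of edges leaving `X` after joining every vertex of `S` to a new vertex. -/
noncomputable def extCut (G : Multigraph V) (S X : Finset V) : ℕ :=
  G.cut X (G.verts \ X) + (X ∩ S).card

theorem extCut_add_extCut (G : Multigraph V) (S : Finset V) {X Y : Finset V}
    (hX : X ⊆ G.verts) (hY : Y ⊆ G.verts) :
    ∃ ab ac ad bc bd cd a b c : ℕ,
      G.extCut S X = ac + ad + bc + bd + a + b ∧
      G.extCut S Y = ab + ad + bc + cd + a + c ∧
      G.extCut S (X ∩ Y) = ab + ac + ad + a ∧
      G.extCut S (X ∪ Y) = ad + bd + cd + a + b + c ∧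
      G.extCut S (X \ Y) = ab + bc + bd + b ∧
      G.extCut S (Y \ X) = ac + bc + cd + c ∧
      a = ((X ∩ Y) ∩ S).card := by
  set A := X ∩ Y with hA
  set B := X \ Y with hB
  set C := Y \ X with hC
  set D := G.verts \ (X ∪ Y) with hD
  have dAB : Disjoint A B := by
    rw [Finset.disjoint_left]; simp [hA, hB]; tauto
  have dAC : Disjoint A C := by
    rw [Finset.disjoint_left]; simp [hA, hC]; tauto
  have dAD : Disjoint A D := by
    rw [Finset.disjoint_left]; simp [hA, hD]; tauto
  have dBC : Disjoint B C := by
    rw [Finset.disjoint_left]; simp [hB, hC]; tauto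
  have dBD : Disjoint B D := by
    rw [Finset.disjoint_left]; simp [hB, hD]; tauto
  have dCD : Disjoint C D := by
    rw [Finset.disjoint_left]; simp [hC, hD]; tauto
  have eX : X = A ∪ B := by ext v; simp [hA, hB]; tauto
  have eY : Y = A ∪ C := by ext v; simp [hA, hC]; tauto
  have eU : X ∪ Y = A ∪ B ∪ C := by ext v; simp [hA, hB, hC]; tauto
  have cX : G.verts \ X = C ∪ D := by
    ext v; have := @hX v; have := @hY v; simp [hC, hD]; tauto
  have cY : G.verts \ Y = B ∪ D := by
    ext v; have := @hX v; have := @hY v; simp [hB, hD]; tauto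
  have cA : G.verts \ A = B ∪ C ∪ D := by
    ext v; have := @hX v; have := @hY v; simp [hA, hB, hC, hD]; tauto
  have cB : G.verts \ B = A ∪ C ∪ D := by
    ext v; have := @hX v; have := @hY v; simp [hA, hB, hC, hD]; tauto
  have cC : G.verts \ C = A ∪ B ∪ D := by
    ext v; have := @hX v; have := @hY v; simp [hA, hB, hC, hD]; tauto
  have cardU : ∀ P Q : Finset V, Disjoint P Q →
      ((P ∪ Q) ∩ S).card = (P ∩ S).card + (Q ∩ S).card := fun P Q h => by
    rw [Finset.union_inter_distrib_right, Finset.card_union_of_disjoint]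
    exact h.mono Finset.inter_subset_left Finset.inter_subset_left
  refine ⟨G.cut A B, G.cut A C, G.cut A D, G.cut B C, G.cut B D, G.cut C D,
    (A ∩ S).card, (B ∩ S).card, (C ∩ S).card, ?_, ?_, ?_, ?_, ?_, ?_, rfl⟩
  · unfold extCut
    rw [cX, eX, cardU _ _ dAB, cut_union_left _ _ dAB, cut_union_right _ _ dCD,
      cut_union_right _ _ dCD]
    ring
  · unfold extCut
    rw [cY, eY, cardU _ _ dAC, cut_union_left _ _ dAC, cut_union_right _ _ dBD,
      cut_union_right _ _ dBD, G.cut_comm C B]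
    ring
  · unfold extCut
    rw [cA, cut_union_right _ _ (Finset.disjoint_union_left.2 ⟨dBD, dCD⟩),
      cut_union_right _ _ dBC]
  · unfold extCut
    rw [← hD, eU, cardU _ _ (Finset.disjoint_union_left.2 ⟨dAC, dBC⟩), cardU _ _ dAB,
      cut_union_left _ _ (Finset.disjoint_union_left.2 ⟨dAC, dBC⟩), cut_union_left _ _ dAB]
    ring
  · unfold extCut
    rw [cB, cut_union_right _ _ (Finset.disjoint_union_left.2 ⟨dAD, dCD⟩),
      cut_union_right _ _ dAC, G.cut_comm B A]
  · unfold extCut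
    rw [cC, cut_union_right _ _ (Finset.disjoint_union_left.2 ⟨dAD, dBD⟩),
      cut_union_right _ _ dAB, G.cut_comm C A, G.cut_comm C B]

theorem cut_singleton_compl (G : Multigraph V) (u : V) (hu : u ∈ G.verts)
    (h0 : G.mult s(u, u) = 0) : G.cut {u} (G.verts \ {u}) = G.deg u := by
  rw [deg_eq_sum, ← Finset.sum_sdiff (Finset.singleton_subset_iff.2 hu)]
  simp [cut, h0]

theorem cut_le_sum_deg (G : Multigraph V) {A B : Finset V} (hB : B ⊆ G.verts) :
    G.cut A B ≤ ∑ u ∈ A, G.deg u := by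
  refine Finset.sum_le_sum fun u _ => ?_
  rw [deg_eq_sum]
  exact Finset.sum_le_sum_of_subset hB

theorem sum_deg_eq (G : Multigraph V) {A X : Finset V} (hX : X ⊆ G.verts) :
    ∑ u ∈ A, G.deg u = G.cut A X + G.cut A (G.verts \ X) := by
  rw [← cut_union_right _ _ Finset.disjoint_sdiff, Finset.union_sdiff_of_subset hX]
  simp [cut, deg_eq_sum]

/-- If every edge between vertices outside `S` were crossed by a tight set with at least
two vertices outside `S`, uncrossing a minimal such set would give a contradiction. -/
theorem exists_edge_not_tight (G : Multigraph V) (S : Finset V)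
    (hScard : S.card ≤ 3) (hsimple : G.IsSimple)
    (hcut : ∀ X ⊆ G.verts, (X \ S).Nonempty → 3 ≤ G.extCut S X)
    (hdeg3 : ∀ v ∈ G.verts, v ∉ S → G.deg v = 3) (hdegS : ∀ v ∈ S, G.deg v ≤ 2)
    {a b : V} (ha : a ∉ S) (hb : b ∉ S) (hab : G.Adj a b) :
    ∃ x y : V, x ∉ S ∧ y ∉ S ∧ G.Adj x y ∧
      ∀ X ⊆ G.verts, 2 ≤ (X \ S).card → (x ∈ X ↔ y ∉ X) → G.extCut S X ≠ 3 := by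
  by_contra hcon
  push Not at hcon
  have key : ∀ n : ℕ, ∀ X ⊆ G.verts, X.card = n → 2 ≤ (X \ S).card → G.extCut S X = 3 →
      ∀ x y, x ∉ S → y ∉ S → G.Adj x y → x ∈ X → y ∉ X → False := by
    intro n
    induction n using Nat.strong_induction_on with
    | _ n ih =>
    intro X hX hn hX2 hX3 x y hx hy hxy hxX hyX
    have hind : ∀ u ∈ X \ S, ∀ v ∈ X \ S, G.mult s(u, v) = 0 := by
      intro u hu v hv
      by_contra huv
      have huv' : G.Adj u v := ⟨fun h => huv (by rw [h]; exact hsimple.2 v), huv⟩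
      obtain ⟨Y, hY, hY2, hsep, hY3⟩ := hcon u v (Finset.mem_sdiff.1 hu).2
        (Finset.mem_sdiff.1 hv).2 huv'
      clear huv
      wlog huY : u ∈ Y generalizing u v
      · exact this v hv u hu huv'.symm (by tauto) (by tauto)
      have hvY : v ∉ Y := hsep.1 huY
      rw [Finset.mem_sdiff] at hu hv
      obtain ⟨ab, ac, ad, bc, bd, cd, α, β, γ, e1, e2, e3, e4, e5, e6, e7⟩ :=
        G.extCut_add_extCut S hX hY
      have hA := hcut (X ∩ Y) (Finset.inter_subset_left.trans hX)
        ⟨u, by simp [hu.1, hu.2, huY]⟩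
      have hU := hcut (X ∪ Y) (Finset.union_subset hX hY) ⟨u, by simp [hu.1, hu.2]⟩
      have hB := hcut (X \ Y) (Finset.sdiff_subset.trans hX) ⟨v, by simp [hv.1, hv.2, hvY]⟩
      by_cases hA2 : 2 ≤ ((X ∩ Y) \ S).card
      · refine ih (X ∩ Y).card ?_ (X ∩ Y) (Finset.inter_subset_left.trans hX) rfl hA2
          (by omega) u v hu.2 hv.2 huv' (by simp [hu.1, huY]) (by simp [hvY])
        rw [← hn]
        refine Finset.card_lt_card ⟨Finset.inter_subset_left, fun h => hvY ?_⟩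
        exact (Finset.mem_inter.1 (h hv.1)).2
      · have hYS : ((X ∩ Y) \ S).card + ((Y \ X) \ S).card = (Y \ S).card := by
          rw [← Finset.card_union_of_disjoint]
          · congr 1; ext v; simp; tauto
          · rw [Finset.disjoint_left]; simp; tauto
        have hC := hcut (Y \ X) (Finset.sdiff_subset.trans hY)
          (Finset.card_pos.1 (by omega))
        have hα : α = 0 := by omega
        have hAu : X ∩ Y = {u} := by
          rw [e7, Finset.card_eq_zero] at hα
          have h1 : (X ∩ Y) \ S = X ∩ Y := by
            rw [Finset.sdiff_eq_self_iff_disjoint, Finset.disjoint_iff_inter_eq_empty, hα]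
          rw [h1] at hA2
          refine (Finset.eq_of_subset_of_card_le (by simp [hu.1, huY]) ?_).symm
          simp; omega
        have h3 : G.extCut S (X ∩ Y) = 3 := by
          have := e7
          unfold extCut
          rw [← this, hα, hAu, G.cut_singleton_compl u (hX hu.1) (hsimple.2 u),
            hdeg3 u (hX hu.1) hu.2]
        omega
    have hXd : X = (X \ S) ∪ (X ∩ S) := (Finset.sdiff_union_inter X S).symm
    have hdisj : Disjoint (X \ S) (X ∩ S) := by
      rw [Finset.disjoint_left]; simp; tauto
    have h1 : ∑ u ∈ X \ S, G.deg u = 3 * (X \ S).card := by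
      rw [Finset.sum_congr rfl fun u hu => hdeg3 u (hX (Finset.mem_sdiff.1 hu).1)
        (Finset.mem_sdiff.1 hu).2]
      simp [mul_comm]
    have h2 := G.sum_deg_eq (A := X \ S) hX
    have h3 : G.cut (X \ S) X = G.cut (X \ S) (X ∩ S) := by
      conv_lhs => rw [hXd, Finset.sdiff_union_inter]
      have : G.cut (X \ S) ((X \ S) ∪ (X ∩ S)) = _ := cut_union_right _ _ hdisj
      rw [← hXd] at this
      rw [this]
      have : G.cut (X \ S) (X \ S) = 0 :=
        Finset.sum_eq_zero fun u hu => Finset.sum_eq_zero fun v hv => hind u hu v hv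
      omega
    have h4 : G.cut (X \ S) (X ∩ S) ≤ 2 * (X ∩ S).card := by
      rw [cut_comm]
      refine (G.cut_le_sum_deg (Finset.sdiff_subset.trans hX)).trans ?_
      refine (Finset.sum_le_card_nsmul _ _ 2 fun u hu =>
        hdegS u (Finset.mem_inter.1 hu).2).trans ?_
      simp [mul_comm]
    have h5 : G.cut X (G.verts \ X) =
        G.cut (X \ S) (G.verts \ X) + G.cut (X ∩ S) (G.verts \ X) := by
      rw [← cut_union_left _ _ hdisj, ← hXd]
    have h6 : 1 ≤ G.cut (X \ S) (G.verts \ X) := by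
      refine (Nat.one_le_iff_ne_zero.2 hxy.2).trans ?_
      refine le_trans ?_ (Finset.single_le_sum (fun _ _ => Nat.zero_le _)
        (Finset.mem_sdiff.2 ⟨hxX, hx⟩))
      exact Finset.single_le_sum (f := fun v => G.mult s(x, v)) (fun _ _ => Nat.zero_le _)
        (Finset.mem_sdiff.2 ⟨hxy.symm.left_mem, hyX⟩)
    have h7 : (X ∩ S).card ≤ 3 := (Finset.card_le_card Finset.inter_subset_right).trans hScard
    unfold extCut at hX3
    omega
  obtain ⟨X, hX, hX2, hsep, hX3⟩ := hcon a b ha hb hab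
  by_cases haX : a ∈ X
  · exact key _ X hX rfl hX2 hX3 a b ha hb hab haX (hsep.1 haX)
  · exact key _ X hX rfl hX2 hX3 b a hb ha hab.symm (by tauto) haX

end Multigraph

section Flow

variable {V : Type}

theorem mem_of_mem_zip_tail {l : List V} {u v : V} (h : (u, v) ∈ l.zip l.tail) :
    u ∈ l ∧ v ∈ l :=
  ⟨(List.of_mem_zip h).1, List.mem_of_mem_tail (List.of_mem_zip h).2⟩

theorem List.IsChain.rel_of_mem_zip_tail {r : V → V → Prop} {l : List V} (hl : l.IsChain r)
    {u v : V} (h : (u, v) ∈ l.zip l.tail) : r u v := by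
  induction l with
  | nil => simp at h
  | cons a l ih =>
    cases l with
    | nil => simp at h
    | cons b l =>
      rw [List.isChain_cons_cons] at hl
      simp only [List.tail_cons, List.zip_cons_cons, List.mem_cons, Prod.mk.injEq] at h
      rcases h with ⟨rfl, rfl⟩ | h
      · exact hl.1
      · exact ih hl.2 h

theorem swap_notMem_zip_tail {l : List V} (hl : l.Nodup) {u v : V}
    (h : (u, v) ∈ l.zip l.tail) : (v, u) ∉ l.zip l.tail := by
  induction l with
  | nil => simp at h
  | cons a l ih =>
    cases l with
    | nil => simp at h
    | cons b l =>
      rw [List.nodup_cons] at hl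
      simp only [List.tail_cons, List.zip_cons_cons, List.mem_cons, Prod.mk.injEq] at h ⊢
      rcases h with ⟨rfl, rfl⟩ | h
      · rintro (⟨h', -⟩ | h')
        · exact hl.1 (h' ▸ List.mem_cons_self ..)
        · exact hl.1 (mem_of_mem_zip_tail (l := v :: l) h').2
      · rintro (⟨rfl, rfl⟩ | h')
        · exact hl.1 (mem_of_mem_zip_tail (l := u :: l) h).2
        · exact ih hl.2 h h'

theorem mem_listEdges {l : List V} {u v : V} :
    s(u, v) ∈ listEdges l ↔ (u, v) ∈ l.zip l.tail ∨ (v, u) ∈ l.zip l.tail := by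
  simp only [listEdges, List.mem_map, Prod.exists, Sym2.eq_iff]
  constructor
  · rintro ⟨a, b, h, ⟨rfl, rfl⟩ | ⟨rfl, rfl⟩⟩
    exacts [Or.inl h, Or.inr h]
  · rintro (h | h)
    exacts [⟨u, v, h, Or.inl ⟨rfl, rfl⟩⟩, ⟨v, u, h, Or.inr ⟨rfl, rfl⟩⟩]

theorem exists_nodup_isChain {r : V → V → Prop} {a b : V} (h : Relation.ReflTransGen r a b) :
    ∃ l : List V, l.Nodup ∧ l.IsChain r ∧ l.head? = some a ∧ l.getLast? = some b := by
  induction h using Relation.ReflTransGen.head_induction_on with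
  | refl => exact ⟨[b], by simp⟩
  | @head a c hac _ ih =>
    obtain ⟨l, hn, hc, hh, ht⟩ := ih
    by_cases ha : a ∈ l
    · obtain ⟨l₁, l₂, rfl⟩ := List.append_of_mem ha
      exact ⟨a :: l₂, hn.of_append_right, hc.right_of_append, rfl, by simpa using ht⟩
    · obtain ⟨l', rfl⟩ : ∃ l', l = c :: l' := by
        cases l with
        | nil => simp at hh
        | cons d l' => exact ⟨l', by simpa using hh⟩
      exact ⟨a :: c :: l', List.nodup_cons.2 ⟨ha, hn⟩, List.isChain_cons_cons.2 ⟨hac, hc⟩, rfl,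
        by simpa using ht⟩

/-- The unit flow along the path `l`. -/
noncomputable def pathFlow (l : List V) (u v : V) : ℤ :=
  (if (u, v) ∈ l.zip l.tail then 1 else 0) - (if (v, u) ∈ l.zip l.tail then 1 else 0)

theorem pathFlow_swap (l : List V) (u v : V) : pathFlow l v u = -pathFlow l u v := by
  simp [pathFlow]

theorem pathFlow_cons_cons {a b : V} {l : List V} (hl : (a :: b :: l).Nodup) (u v : V) :
    pathFlow (a :: b :: l) u v = (if v = b then (if u = a then 1 else 0) else 0)
      - (if v = a then (if u = b then 1 else 0) else 0) + pathFlow (b :: l) u v := by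
  have h : ∀ p q : V, (if (p, q) ∈ (a :: b :: l).zip (a :: b :: l).tail then (1 : ℤ) else 0) =
      (if q = b then (if p = a then 1 else 0) else 0) +
        if (p, q) ∈ (b :: l).zip (b :: l).tail then 1 else 0 := by
    intro p q
    have hnot : ¬ ((p = a ∧ q = b) ∧ (p, q) ∈ (b :: l).zip (b :: l).tail) := by
      rintro ⟨⟨rfl, rfl⟩, h⟩
      exact (List.nodup_cons.1 hl).1 (mem_of_mem_zip_tail h).1
    have hmem : (p, q) ∈ (a :: b :: l).zip (a :: b :: l).tail ↔
        (p = a ∧ q = b) ∨ (p, q) ∈ (b :: l).zip (b :: l).tail := by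
      simp
    by_cases h1 : p = a <;> by_cases h2 : q = b <;>
      by_cases h3 : (p, q) ∈ (b :: l).zip (b :: l).tail <;> simp_all
  unfold pathFlow
  rw [h u v, h v u]
  by_cases h1 : v = a <;> by_cases h2 : u = b <;> simp [h1, h2] <;> ring

theorem sum_pathFlow {l : List V} {W : Finset V} {a b : V} (hn : l.Nodup)
    (hW : ∀ v ∈ l, v ∈ W) (ha : l.head? = some a) (hb : l.getLast? = some b) (u : V) :
    ∑ v ∈ W, pathFlow l u v = (if u = a then 1 else 0) - (if u = b then 1 else 0) := by
  induction l generalizing a with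
  | nil => simp at ha
  | cons c l ih =>
    obtain rfl : c = a := by simpa using ha
    cases l with
    | nil =>
      obtain rfl : c = b := by simpa using hb
      simp [pathFlow]
    | cons d l =>
      have := ih (List.nodup_cons.1 hn).2 (fun v hv => hW v (List.mem_cons_of_mem _ hv))
        (a := d) rfl (by simpa using hb)
      rw [Finset.sum_congr rfl fun v _ => pathFlow_cons_cons hn u v, Finset.sum_add_distrib, this,
        Finset.sum_sub_distrib, Finset.sum_ite_eq', Finset.sum_ite_eq', if_pos (hW d (by simp)),
        if_pos (hW c (by simp))]
      ring

theorem sum_sum_eq_zero_of_swap {f : V → V → ℤ} (hf : ∀ u v, f v u = -f u v) (R : Finset V) :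
    ∑ u ∈ R, ∑ v ∈ R, f u v = 0 := by
  have h : ∑ u ∈ R, ∑ v ∈ R, f u v = -∑ u ∈ R, ∑ v ∈ R, f u v := by
    conv_lhs => rw [Finset.sum_comm]
    simp only [← Finset.sum_neg_distrib, ← hf]
  omega

/-- `f` is an integral flow in the graph `r` on `W` with unit capacities, sending one unit
from `w` to each vertex of `T`. -/
structure IsUnitFlow (r : V → V → Prop) (W : Finset V) (w : V) (T : Finset V)
    (f : V → V → ℤ) : Prop where
  swap : ∀ u v, f v u = -f u v
  le_one : ∀ u v, f u v ≤ 1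
  eq_zero : ∀ u v, ¬ r u v → f u v = 0
  div : ∀ u ∈ W, ∑ v ∈ W, f u v = (if u = w then (T.card : ℤ) else 0) - if u ∈ T then 1 else 0

theorem IsUnitFlow.sum_out {r : V → V → Prop} {W T R : Finset V} {w : V} {f : V → V → ℤ}
    (hf : IsUnitFlow r W w T f) (hR : R ⊆ W) :
    ∑ u ∈ R, ∑ v ∈ W \ R, f u v = (if w ∈ R then (T.card : ℤ) else 0) - (R ∩ T).card := by
  have h : ∑ u ∈ R, ∑ v ∈ W, f u v = ∑ u ∈ R, ∑ v ∈ W \ R, f u v := by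
    rw [← zero_add (∑ u ∈ R, ∑ v ∈ W \ R, f u v), ← sum_sum_eq_zero_of_swap hf.swap R,
      ← Finset.sum_add_distrib]
    refine Finset.sum_congr rfl fun u _ => ?_
    rw [add_comm, Finset.sum_sdiff hR]
  rw [← h, Finset.sum_congr rfl fun u hu => hf.div u (hR hu), Finset.sum_sub_distrib,
    Finset.sum_ite_eq']
  simp

theorem IsUnitFlow.exists_insert {r : V → V → Prop} (hr : ∀ u v, r u v → r v u)
    {W S T : Finset V} {w : V} (hrW : ∀ u v, r u v → u ∈ W) (hw : w ∈ W)
    (hcut : ∀ X ⊆ W, w ∈ X →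
      S.card ≤ (∑ u ∈ X, ∑ v ∈ W \ X, if r u v then 1 else 0) + (X ∩ S).card)
    {f : V → V → ℤ} (hf : IsUnitFlow r W w T f) (hTS : T ⊆ S) (hcard : T.card < S.card) :
    ∃ s ∈ S, s ∉ T ∧ ∃ g, IsUnitFlow r W w (insert s T) g := by
  set R := W.filter fun v => Relation.ReflTransGen (fun u v => r u v ∧ f u v ≤ 0) w v with hR
  have hwR : w ∈ R := by simp [hR, hw, Relation.ReflTransGen.refl]
  have hRW : R ⊆ W := Finset.filter_subset _ _
  by_cases hs : ∃ s ∈ R, s ∈ S ∧ s ∉ T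
  · obtain ⟨s, hsR, hsS, hsT⟩ := hs
    obtain ⟨l, hn, hc, hh, ht⟩ := exists_nodup_isChain (Finset.mem_filter.1 hsR).2
    have hlW : ∀ v ∈ l, v ∈ W := by
      intro v hv
      by_cases hvw : v = w
      · exact hvw ▸ hw
      · obtain ⟨l', rfl⟩ : ∃ l', l = w :: l' := by
          cases l with
          | nil => simp at hh
          | cons d l' => exact ⟨l', by simpa using hh⟩
        have : ∀ (l : List V) (w : V),
            (w :: l).IsChain (fun u v => r u v ∧ f u v ≤ 0) → ∀ v ∈ l, v ∈ W := by
          intro l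
          induction l with
          | nil => simp
          | cons a l ih =>
            intro w hc v hv
            rw [List.isChain_cons_cons] at hc
            rcases List.mem_cons.1 hv with rfl | hv
            · exact hrW _ _ (hr _ _ hc.1.1)
            · exact ih _ hc.2 v hv
        exact this l' w hc v (by simpa [hvw] using hv)
    refine ⟨s, hsS, hsT, fun u v => f u v + pathFlow l u v, ?_, ?_, ?_, ?_⟩
    · intro u v
      rw [hf.swap, pathFlow_swap]; ring
    · intro u v
      have h1 := hf.le_one u v
      unfold pathFlow
      by_cases huv : (u, v) ∈ l.zip l.tail
      · have h2 := (hc.rel_of_mem_zip_tail huv).2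
        simp only [huv, if_true]
        split_ifs <;> linarith
      · simp only [huv, if_false]
        split_ifs <;> linarith
    · intro u v huv
      have h1 : (u, v) ∉ l.zip l.tail := fun h => huv (hc.rel_of_mem_zip_tail h).1
      have h2 : (v, u) ∉ l.zip l.tail := fun h => huv (hr _ _ (hc.rel_of_mem_zip_tail h).1)
      simp [hf.eq_zero u v huv, pathFlow, h1, h2]
    · intro u hu
      rw [Finset.sum_add_distrib, hf.div u hu, sum_pathFlow hn hlW hh ht,
        Finset.card_insert_of_notMem hsT]
      by_cases h1 : u = w <;> by_cases h2 : u = s <;> simp [h1, h2] <;> grind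
  · exfalso
    push Not at hs
    have hout := hf.sum_out hRW
    rw [if_pos hwR] at hout
    have hsat : ∑ u ∈ R, ∑ v ∈ W \ R, f u v =
        ((∑ u ∈ R, ∑ v ∈ W \ R, if r u v then 1 else 0 : ℕ) : ℤ) := by
      push_cast
      refine Finset.sum_congr rfl fun u hu => Finset.sum_congr rfl fun v hv => ?_
      split_ifs with huv
      · by_contra hne
        have hle : f u v ≤ 0 := by
          have := hf.le_one u v
          omega
        refine (Finset.mem_sdiff.1 hv).2 (Finset.mem_filter.2 ⟨(Finset.mem_sdiff.1 hv).1, ?_⟩)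
        exact (Finset.mem_filter.1 hu).2.tail ⟨huv, hle⟩
      · exact hf.eq_zero u v huv
    have hRT : R ∩ S = R ∩ T := by
      ext v
      simp only [Finset.mem_inter]
      exact ⟨fun h => ⟨h.1, hs v h.1 h.2⟩, fun h => ⟨h.1, hTS h.2⟩⟩
    have h := hcut R hRW hwR
    rw [hRT] at h
    omega

theorem exists_isUnitFlow {r : V → V → Prop} (hr : ∀ u v, r u v → r v u)
    {W S : Finset V} {w : V} (hrW : ∀ u v, r u v → u ∈ W) (hw : w ∈ W)
    (hcut : ∀ X ⊆ W, w ∈ X →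
      S.card ≤ (∑ u ∈ X, ∑ v ∈ W \ X, if r u v then 1 else 0) + (X ∩ S).card) :
    ∃ f, IsUnitFlow r W w S f := by
  have h : ∀ n ≤ S.card, ∃ T ⊆ S, T.card = n ∧ ∃ f, IsUnitFlow r W w T f := by
    intro n
    induction n with
    | zero =>
      exact fun _ => ⟨∅, Finset.empty_subset _, rfl, fun _ _ => 0, by simp, by simp, by simp,
        by simp⟩
    | succ n ih =>
      intro hn
      obtain ⟨T, hTS, hT, f, hf⟩ := ih (by omega)
      obtain ⟨s, hsS, hsT, hg⟩ := hf.exists_insert hr hrW hw hcut hTS (by omega)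
      exact ⟨insert s T, Finset.insert_subset hsS hTS,
        by rw [Finset.card_insert_of_notMem hsT, hT], hg⟩
  obtain ⟨T, hTS, hT, hf⟩ := h S.card le_rfl
  rwa [Finset.eq_of_subset_of_card_le hTS hT.ge] at hf

theorem IsUnitFlow.exists_erase {r : V → V → Prop} {W T : Finset V} {w s : V} {f : V → V → ℤ}
    (hf : IsUnitFlow r W w T f) (hrW : ∀ u v, r u v → u ∈ W) (hs : s ∈ T)
    (hsW : s ∈ W) :
    ∃ l : List V, l.Nodup ∧ (∀ v ∈ l, v ∈ W) ∧ l.IsChain (fun u v => f u v = 1) ∧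
      l.head? = some w ∧ l.getLast? = some s ∧
      ∃ g, IsUnitFlow r W w (T.erase s) g ∧
        ∀ u v, g u v ≠ 0 → f u v ≠ 0 ∧ s(u, v) ∉ listEdges l := by
  set R := W.filter fun v => Relation.ReflTransGen (fun u v => f u v = 1) v s with hR
  have hsR : s ∈ R := by simp [hR, hsW, Relation.ReflTransGen.refl]
  have hRW : R ⊆ W := Finset.filter_subset _ _
  have hwR : w ∈ R := by
    by_contra hwR
    have hout := hf.sum_out hRW
    rw [if_neg hwR] at hout
    have hpos : 0 < (R ∩ T).card := Finset.card_pos.2 ⟨s, Finset.mem_inter.2 ⟨hsR, hs⟩⟩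
    have : 0 ≤ ∑ u ∈ R, ∑ v ∈ W \ R, f u v := by
      refine Finset.sum_nonneg fun u hu => Finset.sum_nonneg fun v hv => ?_
      by_contra hneg
      have h1 : f v u = 1 := by
        have := hf.le_one v u
        have := hf.swap u v
        omega
      refine (Finset.mem_sdiff.1 hv).2 (Finset.mem_filter.2 ⟨(Finset.mem_sdiff.1 hv).1, ?_⟩)
      exact (Finset.mem_filter.1 hu).2.head h1
    omega
  obtain ⟨l, hn, hc, hh, ht⟩ := exists_nodup_isChain (Finset.mem_filter.1 hwR).2
  have hadj : ∀ u v, f u v ≠ 0 → r u v := fun u v h => by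
    by_contra h'
    exact h (hf.eq_zero u v h')
  have hlW : ∀ v ∈ l, v ∈ W := by
    have : ∀ l : List V, l.IsChain (fun u v => f u v = 1) → l.getLast? = some s →
        ∀ v ∈ l, v ∈ W := by
      intro l
      induction l with
      | nil => simp
      | cons a l ih =>
        intro hc ht v hv
        cases l with
        | nil =>
          obtain rfl : a = s := by simpa using ht
          obtain rfl : v = a := by simpa using hv
          exact hsW
        | cons b l =>
          rw [List.isChain_cons_cons] at hc
          rcases List.mem_cons.1 hv with rfl | hv
          · exact hrW v b (hadj _ _ (by rw [hc.1]; simp))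
          · exact ih hc.2 (by simpa using ht) v hv
    exact this l hc ht
  have hval : ∀ u v, (s(u, v) ∈ listEdges l ∧ pathFlow l u v = f u v) ∨
      (s(u, v) ∉ listEdges l ∧ pathFlow l u v = 0) := by
    intro u v
    rw [mem_listEdges]
    by_cases h1 : (u, v) ∈ l.zip l.tail
    · have h2 := swap_notMem_zip_tail hn h1
      exact Or.inl ⟨Or.inl h1, by simp [pathFlow, h1, h2, hc.rel_of_mem_zip_tail h1]⟩
    · by_cases h2 : (v, u) ∈ l.zip l.tail
      · refine Or.inl ⟨Or.inr h2, ?_⟩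
        rw [hf.swap v u, hc.rel_of_mem_zip_tail h2]
        simp [pathFlow, h1, h2]
      · exact Or.inr ⟨by tauto, by simp [pathFlow, h1, h2]⟩
  refine ⟨l, hn, hlW, hc, hh, ht, fun u v => f u v - pathFlow l u v, ⟨?_, ?_, ?_, ?_⟩, ?_⟩
  · intro u v
    rw [hf.swap, pathFlow_swap]; ring
  · intro u v
    have := hf.le_one u v
    rcases hval u v with ⟨-, h⟩ | ⟨-, h⟩ <;> simp only [h] <;> omega
  · intro u v huv
    have := hf.eq_zero u v huv
    rcases hval u v with ⟨-, h⟩ | ⟨-, h⟩ <;> simp only [h] <;> omega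
  · intro u hu
    rw [Finset.sum_sub_distrib, hf.div u hu, sum_pathFlow hn hlW hh ht]
    have h1 := Finset.card_erase_add_one hs
    rw [← h1]
    by_cases h1 : u = w <;> by_cases h2 : u = s <;> simp [h1, h2] <;> grind
  · intro u v huv
    rcases hval u v with ⟨-, h⟩ | ⟨h', h⟩
    · simp [h] at huv
    · exact ⟨by simpa [h] using huv, h'⟩

end Flow

namespace Multigraph

variable {V : Type}

theorem threeConnFrom_of_cut (G : Multigraph V) {s₁ s₂ s₃ w : V}
    (h12 : s₁ ≠ s₂) (h13 : s₁ ≠ s₃) (h23 : s₂ ≠ s₃)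
    (hs₁ : s₁ ∈ G.verts) (hs₂ : s₂ ∈ G.verts) (hs₃ : s₃ ∈ G.verts) (hw : w ∈ G.verts)
    (hcut : ∀ X ⊆ G.verts, w ∈ X →
      3 ≤ (∑ u ∈ X, ∑ v ∈ G.verts \ X, if G.Adj u v then 1 else 0)
        + (X ∩ {s₁, s₂, s₃}).card) :
    G.ThreeConnFrom s₁ s₂ s₃ w := by
  have hcard : ({s₁, s₂, s₃} : Finset V).card = 3 := Finset.card_eq_three.2
    ⟨s₁, s₂, s₃, h12, h13, h23, rfl⟩
  have hrW : ∀ u v, G.Adj u v → u ∈ G.verts := fun _ _ h => h.left_mem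
  obtain ⟨f, hf⟩ := exists_isUnitFlow (S := {s₁, s₂, s₃}) (fun _ _ h => Adj.symm h) hrW hw
    (by rwa [hcard])
  obtain ⟨l₁, hn₁, hW₁, hc₁, hh₁, ht₁, g, hg, hgf⟩ := hf.exists_erase hrW (s := s₁)
    (by simp) hs₁
  obtain ⟨l₂, hn₂, hW₂, hc₂, hh₂, ht₂, k, hk, hkg⟩ := hg.exists_erase hrW (s := s₂)
    (by simp [h12.symm]) hs₂
  obtain ⟨l₃, hn₃, hW₃, hc₃, hh₃, ht₃, -⟩ := hk.exists_erase hrW (s := s₃)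
    (by simp [h13.symm, h23.symm]) hs₃
  have hpath : ∀ {T : Finset V} {f : V → V → ℤ} {l : List V} {s : V},
      IsUnitFlow G.Adj G.verts w T f → l.Nodup → (∀ v ∈ l, v ∈ G.verts) →
      l.IsChain (fun u v => f u v = 1) → l.head? = some w → l.getLast? = some s →
      G.IsPathBetween w s l := by
    intro T f l s hf hn hW hc hh ht
    refine ⟨⟨by rintro rfl; simp at hh, hn, hW, hc.imp fun u v huv => ?_⟩, hh, ht⟩
    by_contra h
    rw [hf.eq_zero u v h] at huv
    simp at huv
  have hne : ∀ {f : V → V → ℤ} {l : List V}, (∀ u v, f v u = -f u v) →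
      l.IsChain (fun u v => f u v = 1) → ∀ u v, s(u, v) ∈ listEdges l → f u v ≠ 0 := by
    intro f l hswap hc u v h
    rcases mem_listEdges.1 h with h | h
    · rw [hc.rel_of_mem_zip_tail h]; simp
    · rw [hswap v u, hc.rel_of_mem_zip_tail h]; simp
  refine ⟨l₁, l₂, l₃, hpath hf hn₁ hW₁ hc₁ hh₁ ht₁, hpath hg hn₂ hW₂ hc₂ hh₂ ht₂,
    hpath hk hn₃ hW₃ hc₃ hh₃ ht₃, ?_, ?_, ?_⟩
  · intro e
    induction e with | _ u v
    exact fun h₁ h₂ => (hgf u v (hne hg.swap hc₂ u v h₂)).2 h₁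
  · intro e
    induction e with | _ u v
    exact fun h₁ h₃ => (hgf u v (hkg u v (hne hk.swap hc₃ u v h₃)).1).2 h₁
  · intro e
    induction e with | _ u v
    exact fun h₂ h₃ => (hkg u v (hne hk.swap hc₃ u v h₃)).2 h₂

theorem exists_crossing_of_isPathBetween {G : Multigraph V} {a b : V} {l : List V}
    (hl : G.IsPathBetween a b l) {X : Finset V} (ha : a ∈ X) (hb : b ∉ X) :
    ∃ u ∈ X, ∃ v ∈ G.verts \ X, G.mult s(u, v) ≠ 0 ∧ s(u, v) ∈ listEdges l := by
  obtain ⟨⟨-, -, hW, hc⟩, hh, ht⟩ := hl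
  induction l generalizing a with
  | nil => simp at hh
  | cons c l ih =>
    obtain rfl : c = a := by simpa using hh
    cases l with
    | nil =>
      obtain rfl : c = b := by simpa using ht
      exact absurd ha hb
    | cons d l =>
      have hc' := List.isChain_cons_cons.1 hc
      by_cases hd : d ∈ X
      · obtain ⟨u, hu, v, hv, h1, h2⟩ := ih hd (fun v hv => hW v (List.mem_cons_of_mem _ hv))
          hc'.2 rfl (by simpa using ht)
        exact ⟨u, hu, v, hv, h1, List.mem_cons_of_mem _ h2⟩
      · exact ⟨c, ha, d, Finset.mem_sdiff.2 ⟨hW d (by simp), hd⟩, hc'.1.2, List.mem_cons_self ..⟩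

theorem ThreeConnFrom.le_extCut {G : Multigraph V} {s₁ s₂ s₃ w : V}
    (h12 : s₁ ≠ s₂) (h13 : s₁ ≠ s₃) (h23 : s₂ ≠ s₃) (h : G.ThreeConnFrom s₁ s₂ s₃ w)
    {X : Finset V} (hw : w ∈ X) : 3 ≤ G.extCut {s₁, s₂, s₃} X := by
  obtain ⟨l₁, l₂, l₃, p₁, p₂, p₃, d12, d13, d23⟩ := h
  have hcard : ({s₁, s₂, s₃} : Finset V).card = 3 := Finset.card_eq_three.2
    ⟨s₁, s₂, s₃, h12, h13, h23, rfl⟩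
  set S : Finset V := {s₁, s₂, s₃} with hS
  let L : V → List V := fun s => if s = s₁ then l₁ else if s = s₂ then l₂ else l₃
  have hL₁ : L s₁ = l₁ := by simp [L]
  have hL₂ : L s₂ = l₂ := by simp [L, h12.symm]
  have hL₃ : L s₃ = l₃ := by simp [L, h13.symm, h23.symm]
  have hpath : ∀ s ∈ S, G.IsPathBetween w s (L s) := by
    intro s hs
    simp only [hS, Finset.mem_insert, Finset.mem_singleton] at hs
    rcases hs with rfl | rfl | rfl
    · rwa [hL₁]
    · rwa [hL₂]
    · rwa [hL₃]
  have hdisj : ∀ s ∈ S, ∀ t ∈ S, ∀ e, e ∈ listEdges (L s) → e ∈ listEdges (L t) → s = t := by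
    intro s hs t ht e he he'
    simp only [hS, Finset.mem_insert, Finset.mem_singleton] at hs ht
    rcases hs with rfl | rfl | rfl <;> rcases ht with rfl | rfl | rfl <;>
      first
        | rfl
        | (simp only [hL₁, hL₂, hL₃] at he he'
           first
             | exact (d12 he he').elim | exact (d12 he' he).elim
             | exact (d13 he he').elim | exact (d13 he' he).elim
             | exact (d23 he he').elim | exact (d23 he' he).elim)
  have hcross : ∀ s : V, ∃ p : V × V, s ∈ S \ X →
      p ∈ (X ×ˢ (G.verts \ X)).filter (fun p => G.mult s(p.1, p.2) ≠ 0) ∧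
        s(p.1, p.2) ∈ listEdges (L s) := by
    intro s
    by_cases hs : s ∈ S \ X
    · rw [Finset.mem_sdiff] at hs
      obtain ⟨u, hu, v, hv, h1, h2⟩ :=
        exists_crossing_of_isPathBetween (hpath s hs.1) hw hs.2
      exact ⟨(u, v), fun _ => ⟨by simp [hu, Finset.mem_sdiff.1 hv, h1], h2⟩⟩
    · exact ⟨(s, s), fun h => absurd h hs⟩
  choose p hp using hcross
  have hle : (S \ X).card ≤
      ((X ×ˢ (G.verts \ X)).filter (fun p => G.mult s(p.1, p.2) ≠ 0)).card := by
    refine Finset.card_le_card_of_injOn p (fun s hs => (hp s hs).1) fun s hs t ht hst => ?_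
    have h2 := (hp t ht).2
    rw [← hst] at h2
    exact hdisj s (Finset.mem_sdiff.1 hs).1 t (Finset.mem_sdiff.1 ht).1 _ (hp s hs).2 h2
  have hcut : ((X ×ˢ (G.verts \ X)).filter (fun p => G.mult s(p.1, p.2) ≠ 0)).card ≤
      G.cut X (G.verts \ X) := by
    unfold cut
    rw [← Finset.sum_product', Finset.card_filter]
    refine Finset.sum_le_sum fun p _ => ?_
    split_ifs <;> omega
  have := Finset.card_sdiff_add_card_inter S X
  rw [Finset.inter_comm] at this
  unfold extCut
  omega

end Multigraph

namespace Multigraph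

variable {V : Type}

/-- The multigraph with all positive multiplicities replaced by one. -/
def simplify (G : Multigraph V) : Multigraph V where
  verts := G.verts
  mult e := min 1 (G.mult e)
  supp e he := G.supp e (by omega)

theorem simplify_cut_compl (G : Multigraph V) (X : Finset V) :
    G.simplify.cut X (G.verts \ X) =
      ∑ u ∈ X, ∑ v ∈ G.verts \ X, if G.Adj u v then 1 else 0 := by
  refine Finset.sum_congr rfl fun u hu => Finset.sum_congr rfl fun v hv => ?_
  have huv : u ≠ v := by
    rintro rfl
    exact (Finset.mem_sdiff.1 hv).2 hu
  simp only [simplify, Adj, ne_eq, huv, not_false_eq_true, true_and]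
  split_ifs <;> omega

/-- When degrees are at most three, or two at vertices of `S`, parallel edges do not help
to satisfy the cut condition. -/
theorem le_simplify_extCut (G : Multigraph V) {S : Finset V} {w : V}
    (hdeg : ∀ v ∈ G.verts, v ∉ S → G.deg v ≤ 3) (hdegS : ∀ v ∈ S, G.deg v ≤ 2)
    (hcut : ∀ X ⊆ G.verts, w ∈ X → 3 ≤ G.extCut S X) {X : Finset V} (hX : X ⊆ G.verts)
    (hw : w ∈ X) : 3 ≤ G.simplify.extCut S X := by
  induction hn : (G.verts \ X).card using Nat.strong_induction_on generalizing X with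
  | _ n ih =>
  by_cases hpar : ∃ a ∈ X, ∃ b ∈ G.verts \ X, 2 ≤ G.mult s(a, b)
  · obtain ⟨a, ha, b, hb, hab⟩ := hpar
    have hb' := Finset.mem_sdiff.1 hb
    set Y := G.verts \ insert b X with hY
    have hXb : Disjoint X {b} := by simpa using hb'.2
    have hYb : Disjoint {b} Y := by simp [hY]
    have hXY : Disjoint X ({b} ∪ Y) := by
      rw [Finset.disjoint_left]
      intro v hv
      simp only [hY, Finset.mem_union, Finset.mem_singleton, Finset.mem_sdiff, Finset.mem_insert]
      rintro (rfl | h)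
      · exact hb'.2 hv
      · exact h.2 (Or.inr hv)
    have hVX : G.verts \ X = {b} ∪ Y := by
      ext v
      by_cases hvb : v = b
      · simp [hvb, hb'.1, hb'.2]
      · simp [hY, hvb]
    have hV : G.verts = X ∪ ({b} ∪ Y) := by
      rw [← hVX, Finset.union_sdiff_of_subset hX]
    have hins : insert b X = X ∪ {b} := by
      ext v; simp
    have h := ih Y.card (by
      rw [← hn, hVX, Finset.card_union_of_disjoint hYb]; simp) (X := insert b X)
      (Finset.insert_subset hb'.1 hX) (Finset.mem_insert_of_mem hw) rfl
    have hdegb : G.simplify.cut {b} X + G.simplify.cut {b} Y + 1 ≤ G.deg b := by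
      rw [← cut_union_right _ _ (hXY.mono_right Finset.subset_union_right), deg_eq_sum]
      have ha' : a ∈ X ∪ Y := Finset.mem_union_left _ ha
      have hsub : X ∪ Y ⊆ G.verts := Finset.union_subset hX Finset.sdiff_subset
      refine le_trans ?_ (Finset.sum_le_sum_of_subset hsub)
      have h1 : G.simplify.cut {b} (X ∪ Y) = ∑ v ∈ X ∪ Y, min 1 (G.mult s(b, v)) := by
        simp [cut, simplify]
      rw [h1, ← Finset.add_sum_erase _ _ ha', ← Finset.add_sum_erase _ _ ha']
      have h2 : ∑ v ∈ (X ∪ Y).erase a, min 1 (G.mult s(b, v)) ≤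
          ∑ v ∈ (X ∪ Y).erase a, G.mult s(b, v) :=
        Finset.sum_le_sum fun v _ => min_le_right _ _
      rw [Sym2.eq_swap] at hab
      omega
    have hpos : 1 ≤ G.simplify.cut {b} X := by
      have h1 : G.simplify.cut {b} X = ∑ v ∈ X, min 1 (G.mult s(b, v)) := by
        simp [cut, simplify]
      rw [h1]
      refine le_trans ?_ (Finset.single_le_sum (f := fun v => min 1 (G.mult s(b, v)))
        (fun _ _ => Nat.zero_le _) ha)
      rw [Sym2.eq_swap] at hab
      omega
    have e1 : G.simplify.extCut S X =
        G.simplify.cut {b} X + G.simplify.cut X Y + (X ∩ S).card := by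
      change G.simplify.cut X (G.verts \ X) + _ = _
      rw [hVX, cut_union_right _ _ hYb, cut_comm _ X {b}]
    have e2 : G.simplify.extCut S (insert b X) =
        G.simplify.cut X Y + G.simplify.cut {b} Y + (insert b X ∩ S).card := by
      change G.simplify.cut (insert b X) Y + _ = _
      rw [hins, cut_union_left _ _ hXb]
    by_cases hbS : b ∈ S
    · have := hdegS b hbS
      rw [Finset.insert_inter_of_mem hbS, Finset.card_insert_of_notMem (by simp [hb'.2])] at e2
      omega
    · have := hdeg b hb'.1 hbS
      rw [Finset.insert_inter_of_notMem hbS] at e2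
      omega
  · push Not at hpar
    refine (hcut X hX hw).trans (le_of_eq ?_)
    have : G.cut X (G.verts \ X) = G.simplify.cut X (G.verts \ X) := by
      refine Finset.sum_congr rfl fun u hu => Finset.sum_congr rfl fun v hv => ?_
      have := hpar u hu v hv
      simp only [simplify]
      omega
    unfold extCut
    rw [this]
    rfl

theorem threeConnFrom_of_extCut (G : Multigraph V) {s₁ s₂ s₃ w : V}
    (h12 : s₁ ≠ s₂) (h13 : s₁ ≠ s₃) (h23 : s₂ ≠ s₃)
    (hs₁ : s₁ ∈ G.verts) (hs₂ : s₂ ∈ G.verts) (hs₃ : s₃ ∈ G.verts) (hw : w ∈ G.verts)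
    (hdeg : ∀ v ∈ G.verts, v ∉ ({s₁, s₂, s₃} : Finset V) → G.deg v ≤ 3)
    (hdegS : ∀ v ∈ ({s₁, s₂, s₃} : Finset V), G.deg v ≤ 2)
    (hcut : ∀ X ⊆ G.verts, w ∈ X → 3 ≤ G.extCut {s₁, s₂, s₃} X) :
    G.ThreeConnFrom s₁ s₂ s₃ w := by
  refine G.threeConnFrom_of_cut h12 h13 h23 hs₁ hs₂ hs₃ hw fun X hX hwX => ?_
  rw [← simplify_cut_compl]
  exact G.le_simplify_extCut hdeg hdegS hcut hX hwX

/-- The H-reduction by an edge `{x, y}` whose ends have degree three, the other neighbours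
being `z₁, z₂` and `t₁, t₂`. -/
noncomputable def hReduction (G : Multigraph V) (x y : V) {z₁ z₂ t₁ t₂ : V}
    (hz₁ : z₁ ∈ G.verts \ {x, y}) (hz₂ : z₂ ∈ G.verts \ {x, y})
    (ht₁ : t₁ ∈ G.verts \ {x, y}) (ht₂ : t₂ ∈ G.verts \ {x, y}) : Multigraph V where
  verts := G.verts \ {x, y}
  mult e := (if x ∈ e ∨ y ∈ e then 0 else G.mult e) + (if e = s(z₁, z₂) then 1 else 0)
    + (if e = s(t₁, t₂) then 1 else 0)
  supp e he v hv := by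
    by_cases h1 : e = s(z₁, z₂)
    · rw [h1, Sym2.mem_iff] at hv
      rcases hv with rfl | rfl <;> assumption
    by_cases h2 : e = s(t₁, t₂)
    · rw [h2, Sym2.mem_iff] at hv
      rcases hv with rfl | rfl <;> assumption
    by_cases h3 : x ∈ e ∨ y ∈ e
    · simp [h1, h2, h3] at he
    · simp only [h1, h2, h3, if_false, add_zero] at he
      have := G.supp e he v hv
      simp only [Finset.mem_sdiff, this, Finset.mem_insert, Finset.mem_singleton, true_and]
      rintro (rfl | rfl) <;> tauto

theorem ite_sym2_eq {a b : V} (hab : a ≠ b) (u v : V) :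
    (if s(u, v) = s(a, b) then 1 else 0 : ℕ) =
      (if v = b then (if u = a then 1 else 0) else 0) +
        (if v = a then (if u = b then 1 else 0) else 0) := by
  simp only [Sym2.eq_iff]
  by_cases h1 : v = a <;> by_cases h2 : v = b <;> by_cases h3 : u = a <;>
    by_cases h4 : u = b <;> simp_all

theorem sum_ite_sym2_eq {a b : V} {W : Finset V} (ha : a ∈ W) (hb : b ∈ W) (hab : a ≠ b)
    (u : V) : ∑ v ∈ W, (if s(u, v) = s(a, b) then 1 else 0 : ℕ) =
      (if u = a then 1 else 0) + (if u = b then 1 else 0) := by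
  simp only [ite_sym2_eq hab]
  simp [Finset.sum_add_distrib, ha, hb]

theorem sum_sum_ite_sym2_eq {a b : V} {W X : Finset V} (ha : a ∈ W) (hb : b ∈ W) (hab : a ≠ b)
    :
    ∑ u ∈ X, ∑ v ∈ W \ X, (if s(u, v) = s(a, b) then 1 else 0 : ℕ) =
      if (a ∈ X ↔ b ∉ X) then 1 else 0 := by
  simp only [ite_sym2_eq hab]
  by_cases h1 : a ∈ X <;> by_cases h2 : b ∈ X <;>
    simp [Finset.sum_add_distrib, ha, hb, h1, h2]

end Multigraph

namespace Multigraph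

variable {V : Type}

/-- The ends `x`, `y` of an edge have degree three; `z₁, z₂` are the other neighbours of `x`
and `t₁, t₂` those of `y`. -/
structure CubicEdge (G : Multigraph V) (x y z₁ z₂ t₁ t₂ : V) : Prop where
  left_mem : x ∈ G.verts
  right_mem : y ∈ G.verts
  ne : x ≠ y
  mult_eq_one : G.mult s(x, y) = 1
  z₁_mem : z₁ ∈ G.verts \ {x, y}
  z₂_mem : z₂ ∈ G.verts \ {x, y}
  t₁_mem : t₁ ∈ G.verts \ {x, y}
  t₂_mem : t₂ ∈ G.verts \ {x, y}
  z_ne : z₁ ≠ z₂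
  t_ne : t₁ ≠ t₂
  nbrs_left : G.nbrs x = {y, z₁, z₂}
  nbrs_right : G.nbrs y = {x, t₁, t₂}

theorem exists_nbrs_eq {G : Multigraph V} (hsimple : G.IsSimple) {x y : V}
    (hxy : G.Adj x y) (hx : G.deg x = 3) :
    ∃ z₁ z₂, G.nbrs x = {y, z₁, z₂} ∧ z₁ ≠ z₂ ∧ z₁ ∈ G.verts \ {x, y} ∧
      z₂ ∈ G.verts \ {x, y} := by
  have hy : y ∈ G.nbrs x := by
    rw [← Multiset.count_pos, count_nbrs]
    exact Nat.pos_of_ne_zero hxy.2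
  obtain ⟨t, ht⟩ := Multiset.exists_cons_of_mem hy
  have htc : t.card = 2 := by
    have h : (G.nbrs x).card = 3 := hx
    rw [ht, Multiset.card_cons] at h
    omega
  obtain ⟨z₁, z₂, rfl⟩ := Multiset.card_eq_two.1 htc
  have hle : ∀ v, (G.nbrs x).count v ≤ 1 := fun v => by
    rw [count_nbrs]; exact hsimple.1 _
  have hnd : (G.nbrs x).Nodup := Multiset.nodup_iff_count_le_one.2 hle
  have hmem : ∀ v ∈ G.nbrs x, v ∈ G.verts ∧ v ≠ x := by
    intro v hv
    rw [← Multiset.count_pos, count_nbrs] at hv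
    refine ⟨G.supp _ hv.ne' v (by simp), ?_⟩
    rintro rfl
    rw [hsimple.2] at hv
    exact lt_irrefl _ hv
  have h₁ := hmem z₁ (by rw [ht]; simp)
  have h₂ := hmem z₂ (by rw [ht]; simp)
  rw [ht] at hnd
  simp only [Multiset.insert_eq_cons, Multiset.nodup_cons, Multiset.mem_cons,
    Multiset.mem_singleton, not_or] at hnd
  exact ⟨z₁, z₂, ht, hnd.2.1, by simp [h₁, Ne.symm hnd.1.1], by simp [h₂, Ne.symm hnd.1.2]⟩

theorem exists_cubicEdge {G : Multigraph V} (hsimple : G.IsSimple) {x y : V}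
    (hxy : G.Adj x y) (hx : G.deg x = 3) (hy : G.deg y = 3) :
    ∃ z₁ z₂ t₁ t₂, G.CubicEdge x y z₁ z₂ t₁ t₂ := by
  obtain ⟨z₁, z₂, hz, hzne, hz₁, hz₂⟩ := exists_nbrs_eq hsimple hxy hx
  obtain ⟨t₁, t₂, ht, htne, ht₁, ht₂⟩ := exists_nbrs_eq hsimple hxy.symm hy
  rw [Finset.pair_comm] at ht₁ ht₂
  have := hsimple.1 s(x, y)
  exact ⟨z₁, z₂, t₁, t₂, hxy.left_mem, hxy.symm.left_mem, hxy.1,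
    le_antisymm this (Nat.one_le_iff_ne_zero.2 hxy.2), hz₁, hz₂, ht₁, ht₂, hzne, htne, hz, ht⟩

namespace CubicEdge

variable {G : Multigraph V} {x y z₁ z₂ t₁ t₂ : V}

theorem mult_left (h : G.CubicEdge x y z₁ z₂ t₁ t₂) {v : V} (hv : v ≠ y) :
    G.mult s(x, v) = (if v = z₁ then 1 else 0) + (if v = z₂ then 1 else 0) := by
  rw [← count_nbrs, h.nbrs_left]
  simp only [Multiset.insert_eq_cons, Multiset.count_cons, Multiset.count_singleton, hv, if_false]
  omega

theorem mult_right (h : G.CubicEdge x y z₁ z₂ t₁ t₂) {v : V} (hv : v ≠ x) :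
    G.mult s(y, v) = (if v = t₁ then 1 else 0) + (if v = t₂ then 1 else 0) := by
  rw [← count_nbrs, h.nbrs_right]
  simp only [Multiset.insert_eq_cons, Multiset.count_cons, Multiset.count_singleton, hv, if_false]
  omega

/-- The H-reduction by the edge `{x, y}`. -/
noncomputable abbrev reduction (h : G.CubicEdge x y z₁ z₂ t₁ t₂) : Multigraph V :=
  G.hReduction x y h.z₁_mem h.z₂_mem h.t₁_mem h.t₂_mem

theorem hReducible (h : G.CubicEdge x y z₁ z₂ t₁ t₂) : G.HReducible x y :=
  ⟨h.left_mem, h.right_mem, h.ne, h.mult_eq_one, by simp [deg, h.nbrs_left],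
    by simp [deg, h.nbrs_right]⟩

theorem isHReductionBy (h : G.CubicEdge x y z₁ z₂ t₁ t₂) :
    G.IsHReductionBy x y h.reduction := by
  refine ⟨h.hReducible, Or.inl ⟨by simp [deg, h.nbrs_left], by simp [deg, h.nbrs_right],
    z₁, z₂, t₁, t₂, h.nbrs_left, h.nbrs_right, fun v => ?_, fun e => rfl⟩⟩
  simp [hReduction]

theorem reduction_mult (h : G.CubicEdge x y z₁ z₂ t₁ t₂) {u v : V}
    (hu : u ∈ G.verts \ {x, y}) (hv : v ∈ G.verts \ {x, y}) :
    h.reduction.mult s(u, v) = G.mult s(u, v) + (if s(u, v) = s(z₁, z₂) then 1 else 0)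
      + (if s(u, v) = s(t₁, t₂) then 1 else 0) := by
  simp only [Finset.mem_sdiff, Finset.mem_insert, Finset.mem_singleton, not_or] at hu hv
  have : ¬ (x ∈ s(u, v) ∨ y ∈ s(u, v)) := by
    simp only [Sym2.mem_iff]
    rintro ((rfl | rfl) | (rfl | rfl)) <;> simp at hu hv
  change (if x ∈ s(u, v) ∨ y ∈ s(u, v) then 0 else G.mult s(u, v)) + _ + _ = _
  rw [if_neg this]

theorem reduction_deg (h : G.CubicEdge x y z₁ z₂ t₁ t₂) {v : V} (hv : v ∈ G.verts \ {x, y}) :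
    h.reduction.deg v = G.deg v := by
  have hv' : v ≠ x ∧ v ≠ y := by simpa using (Finset.mem_sdiff.1 hv).2
  have hsub : ({x, y} : Finset V) ⊆ G.verts :=
    Finset.insert_subset h.left_mem (Finset.singleton_subset_iff.2 h.right_mem)
  rw [deg_eq_sum, deg_eq_sum, ← Finset.sum_sdiff hsub, Finset.sum_pair h.ne,
    Sym2.eq_swap (a := v) (b := x), Sym2.eq_swap (a := v) (b := y), h.mult_left hv'.2,
    h.mult_right hv'.1]
  change ∑ u ∈ G.verts \ {x, y}, h.reduction.mult s(v, u) = _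
  rw [Finset.sum_congr rfl fun u hu => h.reduction_mult hv hu, Finset.sum_add_distrib,
    Finset.sum_add_distrib, sum_ite_sym2_eq h.z₁_mem h.z₂_mem h.z_ne,
    sum_ite_sym2_eq h.t₁_mem h.t₂_mem h.t_ne, add_assoc]

theorem cut_left (h : G.CubicEdge x y z₁ z₂ t₁ t₂) {A : Finset V}
    (hA : A ⊆ G.verts \ {x, y}) :
    G.cut {x} A = (if z₁ ∈ A then 1 else 0) + (if z₂ ∈ A then 1 else 0) := by
  have : G.cut {x} A =
      ∑ v ∈ A, ((if v = z₁ then 1 else 0) + (if v = z₂ then 1 else 0)) := by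
    simp only [cut, Finset.sum_singleton]
    exact Finset.sum_congr rfl fun v hv => h.mult_left fun hvy => by
      simpa [hvy] using hA hv
  rw [this, Finset.sum_add_distrib, Finset.sum_ite_eq', Finset.sum_ite_eq']

theorem cut_right (h : G.CubicEdge x y z₁ z₂ t₁ t₂) {A : Finset V}
    (hA : A ⊆ G.verts \ {x, y}) :
    G.cut {y} A = (if t₁ ∈ A then 1 else 0) + (if t₂ ∈ A then 1 else 0) := by
  have : G.cut {y} A =
      ∑ v ∈ A, ((if v = t₁ then 1 else 0) + (if v = t₂ then 1 else 0)) := by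
    simp only [cut, Finset.sum_singleton]
    exact Finset.sum_congr rfl fun v hv => h.mult_right fun hvx => by
      simpa [hvx] using hA hv
  rw [this, Finset.sum_add_distrib, Finset.sum_ite_eq', Finset.sum_ite_eq']

theorem reduction_cut (h : G.CubicEdge x y z₁ z₂ t₁ t₂) {X : Finset V}
    (hX : X ⊆ G.verts \ {x, y}) :
    h.reduction.cut X ((G.verts \ {x, y}) \ X) = G.cut X ((G.verts \ {x, y}) \ X) +
      (if (z₁ ∈ X ↔ z₂ ∉ X) then 1 else 0) + (if (t₁ ∈ X ↔ t₂ ∉ X) then 1 else 0) := by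
  rw [← sum_sum_ite_sym2_eq h.z₁_mem h.z₂_mem h.z_ne,
    ← sum_sum_ite_sym2_eq h.t₁_mem h.t₂_mem h.t_ne]
  simp only [cut, ← Finset.sum_add_distrib]
  exact Finset.sum_congr rfl fun u hu => Finset.sum_congr rfl fun v hv =>
    h.reduction_mult (hX hu) (Finset.mem_sdiff.1 hv).1

/-- Every vertex set `X` of the reduction extends to a vertex set of `G` whose cut is larger
only by the edge `{x, y}`, and only if it separates `x` from `y`. -/
theorem exists_extCut_eq (h : G.CubicEdge x y z₁ z₂ t₁ t₂) {S X : Finset V}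
    (hx : x ∉ S) (hy : y ∉ S) (hX : X ⊆ G.verts \ {x, y}) :
    ∃ X' ⊆ G.verts, X ⊆ X' ∧
      G.extCut S X' = h.reduction.extCut S X + if (x ∈ X' ↔ y ∉ X') then 1 else 0 := by
  set W := G.verts \ {x, y} with hW
  set Y := W \ X with hY
  have hYW : Y ⊆ W := Finset.sdiff_subset
  have hxW : x ∉ W := by simp [hW]
  have hyW : y ∉ W := by simp [hW]
  have hxX : x ∉ X := fun h => hxW (hX h)
  have hyX : y ∉ X := fun h => hyW (hX h)
  have hxY : x ∉ Y := fun h => hxW (hYW h)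
  have hyY : y ∉ Y := fun h => hyW (hYW h)
  have hxy := h.ne
  have hcut := h.reduction_cut hX
  have hxc : G.cut {x} {y} = 1 := by simp [cut, h.mult_eq_one]
  have hyc : G.cut {y} {x} = 1 := by rw [cut_comm, hxc]
  have hmemY : ∀ v ∈ W, (v ∈ Y ↔ v ∉ X) := fun v hv => by simp [hY, hv]
  have z₁Y := hmemY _ h.z₁_mem
  have z₂Y := hmemY _ h.z₂_mem
  have t₁Y := hmemY _ h.t₁_mem
  have t₂Y := hmemY _ h.t₂_mem
  have hred : h.reduction.extCut S X = G.cut X Y + (if (z₁ ∈ X ↔ z₂ ∉ X) then 1 else 0) +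
      (if (t₁ ∈ X ↔ t₂ ∉ X) then 1 else 0) + (X ∩ S).card := by
    rw [← hcut]; rfl
  have hsdiff : ∀ v ∈ X, v ∈ G.verts ∧ v ≠ x ∧ v ≠ y := fun v hv => by
    simpa [hW] using hX hv
  have dX : ∀ v ∉ X, Disjoint X {v} := fun v hv => by simpa using hv
  have dY : ∀ v ∉ Y, Disjoint Y {v} := fun v hv => by simpa using hv
  have dXxy : Disjoint (X ∪ {x}) {y} := by
    rw [Finset.disjoint_union_left]; exact ⟨dX y hyX, by simpa using hxy⟩
  have dYxy : Disjoint (Y ∪ {x}) {y} := by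
    rw [Finset.disjoint_union_left]; exact ⟨dY y hyY, by simpa using hxy⟩
  have hXx := h.cut_left hX
  have hYx := h.cut_left hYW
  have hXy := h.cut_right hX
  have hYy := h.cut_right hYW
  simp only [z₁Y, z₂Y] at hYx
  simp only [t₁Y, t₂Y] at hYy
  have hxm := h.left_mem
  have hym := h.right_mem
  by_cases hz : z₁ ∈ X <;> by_cases ht : t₁ ∈ X
  · refine ⟨X ∪ {x} ∪ {y}, ?_, ?_, ?_⟩
    · intro v; have := hsdiff v; grind
    · intro v; grind
    · have e1 : G.verts \ (X ∪ {x} ∪ {y}) = Y := by ext v; grind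
      have e2 : (X ∪ {x} ∪ {y}) ∩ S = X ∩ S := by ext v; grind
      rw [hred, extCut, e1, e2, cut_union_left _ _ dXxy, cut_union_left _ _ (dX x hxX)]
      grind
  · refine ⟨X ∪ {x}, ?_, ?_, ?_⟩
    · intro v; have := hsdiff v; grind
    · intro v; grind
    · have e1 : G.verts \ (X ∪ {x}) = Y ∪ {y} := by ext v; grind
      have e2 : (X ∪ {x}) ∩ S = X ∩ S := by ext v; grind
      rw [hred, extCut, e1, e2, cut_union_left _ _ (dX x hxX), cut_union_right _ _ (dY y hyY),
        cut_union_right _ _ (dY y hyY), hxc, G.cut_comm X {y}]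
      grind
  · refine ⟨X ∪ {y}, ?_, ?_, ?_⟩
    · intro v; have := hsdiff v; grind
    · intro v; grind
    · have e1 : G.verts \ (X ∪ {y}) = Y ∪ {x} := by ext v; grind
      have e2 : (X ∪ {y}) ∩ S = X ∩ S := by ext v; grind
      rw [hred, extCut, e1, e2, cut_union_left _ _ (dX y hyX), cut_union_right _ _ (dY x hxY),
        cut_union_right _ _ (dY x hxY), hyc, G.cut_comm X {x}]
      grind
  · refine ⟨X, ?_, ?_, ?_⟩
    · intro v; have := hsdiff v; grind
    · intro v; grind
    · have e1 : G.verts \ X = Y ∪ {x} ∪ {y} := by ext v; grind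
      rw [hred, extCut, e1, cut_union_right _ _ dYxy, cut_union_right _ _ (dY x hxY),
        G.cut_comm X {x}, G.cut_comm X {y}]
      grind

end CubicEdge

end Multigraph

/-- **Existence of strongly H-reducible edges** (Proposition 4.7).
Let `G` be a finite connected simple graph, 3-connected to `S = {s₁, s₂, s₃}`,
with all vertices outside `S` of degree 3, and all vertices of `S` of degree at most 2.
If there are two adjacent vertices outside `S`, then `G` contains a strongly
H-reducible edge: an H-reducible edge between vertices outside `S` whose H-reduction
is still 3-connected to `S`. -/
theorem exists_strongly_hreducible_edge
    {V : Type} (G : Multigraph V) (s₁ s₂ s₃ : V)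
    (h12 : s₁ ≠ s₂) (h13 : s₁ ≠ s₃) (h23 : s₂ ≠ s₃)
    (hs₁ : s₁ ∈ G.verts) (hs₂ : s₂ ∈ G.verts) (hs₃ : s₃ ∈ G.verts)
    (hsimple : G.IsSimple) (hconn : G.Connected)
    (h3c : G.ThreeConnTo s₁ s₂ s₃)
    (hdeg3 : ∀ v ∈ G.verts, v ≠ s₁ → v ≠ s₂ → v ≠ s₃ → G.deg v = 3)
    (hdegS1 : G.deg s₁ ≤ 2) (hdegS2 : G.deg s₂ ≤ 2) (hdegS3 : G.deg s₃ ≤ 2)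
    (hadj : ∃ a b : V, a ∈ G.verts ∧ b ∈ G.verts ∧
      a ≠ s₁ ∧ a ≠ s₂ ∧ a ≠ s₃ ∧ b ≠ s₁ ∧ b ≠ s₂ ∧ b ≠ s₃ ∧ G.Adj a b) :
    ∃ x y : V, x ∈ G.verts ∧ y ∈ G.verts ∧
      x ≠ s₁ ∧ x ≠ s₂ ∧ x ≠ s₃ ∧ y ≠ s₁ ∧ y ≠ s₂ ∧ y ≠ s₃ ∧
      G.HReducible x y ∧
      ∃ G' : Multigraph V, G.IsHReductionBy x y G' ∧ G'.ThreeConnTo s₁ s₂ s₃ := by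

  obtain ⟨a, b, ha, hb, ha₁, ha₂, ha₃, hb₁, hb₂, hb₃, hab⟩ := hadj
  have hcard : ({s₁, s₂, s₃} : Finset V).card = 3 := Finset.card_eq_three.2
    ⟨s₁, s₂, s₃, h12, h13, h23, rfl⟩
  have hmemS : ∀ v, v ∉ ({s₁, s₂, s₃} : Finset V) ↔ v ≠ s₁ ∧ v ≠ s₂ ∧ v ≠ s₃ := by simp
  have hdeg3' : ∀ v ∈ G.verts, v ∉ ({s₁, s₂, s₃} : Finset V) → G.deg v = 3 := fun v hv hvS =>
    let ⟨h₁, h₂, h₃⟩ := (hmemS v).1 hvS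
    hdeg3 v hv h₁ h₂ h₃
  have hdegS : ∀ v ∈ ({s₁, s₂, s₃} : Finset V), G.deg v ≤ 2 := by
    simp [hdegS1, hdegS2, hdegS3]
  have hcut : ∀ X ⊆ G.verts, (X \ {s₁, s₂, s₃}).Nonempty → 3 ≤ G.extCut {s₁, s₂, s₃} X := by
    rintro X hX ⟨w, hw⟩
    rw [Finset.mem_sdiff] at hw
    obtain ⟨h₁, h₂, h₃⟩ := (hmemS w).1 hw.2
    exact (h3c w (hX hw.1) h₁ h₂ h₃).le_extCut h12 h13 h23 hw.1
  obtain ⟨x, y, hxS, hyS, hxy, htight⟩ := G.exists_edge_not_tight {s₁, s₂, s₃} hcard.le hsimple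
    hcut hdeg3' hdegS ((hmemS a).2 ⟨ha₁, ha₂, ha₃⟩) ((hmemS b).2 ⟨hb₁, hb₂, hb₃⟩) hab
  obtain ⟨z₁, z₂, t₁, t₂, h⟩ := Multigraph.exists_cubicEdge hsimple hxy
    (hdeg3' x hxy.left_mem hxS) (hdeg3' y hxy.symm.left_mem hyS)
  obtain ⟨hx₁, hx₂, hx₃⟩ := (hmemS x).1 hxS
  obtain ⟨hy₁, hy₂, hy₃⟩ := (hmemS y).1 hyS
  refine ⟨x, y, h.left_mem, h.right_mem, hx₁, hx₂, hx₃, hy₁, hy₂, hy₃, h.hReducible,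
    h.reduction, h.isHReductionBy, fun w hw hw₁ hw₂ hw₃ => ?_⟩
  have hwS := (hmemS w).2 ⟨hw₁, hw₂, hw₃⟩
  have hmem : ∀ {s : V}, s ∈ G.verts → x ≠ s → y ≠ s → s ∈ G.verts \ {x, y} :=
    fun h h' h'' => by simp [h, h'.symm, h''.symm]
  refine h.reduction.threeConnFrom_of_extCut h12 h13 h23 (hmem hs₁ hx₁ hy₁) (hmem hs₂ hx₂ hy₂)
    (hmem hs₃ hx₃ hy₃) hw (fun v hv hvS => ?_) (fun v hv => ?_) fun X hX hwX => ?_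
  · rw [h.reduction_deg hv, hdeg3' v (Finset.mem_sdiff.1 hv).1 hvS]
  · have hv' : v ∈ G.verts \ {x, y} := by
      simp only [Finset.mem_insert, Finset.mem_singleton] at hv
      rcases hv with rfl | rfl | rfl <;> apply hmem <;> assumption
    rw [h.reduction_deg hv']
    exact hdegS v hv
  · obtain ⟨X', hX', hXX', hext⟩ := h.exists_extCut_eq hxS hyS hX
    have h3 := hcut X' hX' ⟨w, Finset.mem_sdiff.2 ⟨hXX' hwX, hwS⟩⟩
    by_cases hsep : x ∈ X' ↔ y ∉ X'
    · have hw' : w ≠ x ∧ w ≠ y := by simpa using (Finset.mem_sdiff.1 hw).2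
      have hcard2 : 2 ≤ (X' \ {s₁, s₂, s₃}).card := by
        refine Finset.one_lt_card.2 ⟨w, Finset.mem_sdiff.2 ⟨hXX' hwX, hwS⟩, ?_⟩
        by_cases hxX : x ∈ X'
        · exact ⟨x, Finset.mem_sdiff.2 ⟨hxX, hxS⟩, hw'.1⟩
        · exact ⟨y, Finset.mem_sdiff.2 ⟨by tauto, hyS⟩, hw'.2⟩
      have := htight X' hX' hcard2 hsep
      rw [if_pos hsep] at hext
      omega
    · rw [if_neg hsep] at hext
      omega
end
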